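/- Theorem 6.5 (main result): Consider the system of three 1D Schrödinger equations −y'' + V(x) y = λ y on (0,∞) with boundary condition y'(0) = 0 and potential V(x) = D(x;s) + δF(x) as described. If assumptions A1, A2, A3 hold, then there exists δ0 > 0 such that for every δ with 0 < |δ| < δ0, there exist a real parameter value s, a frequency λ ∈ (0,1), and a nontrivial real vector function y solving −y'' + (D(x;s) + δF(x)) y = λ y on (0,∞) with y'(0) = 0 and y(x) → 0 as x → +∞; i.e., the coupled system has a BIC, with (s, λ) near the crossing point (s0, λ0). -/

import Mathlib

open MeasureTheory Set Filter

noncomputable section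

/-- `Sol1D d lam g y y'` : `y` (with derivative `y'`) is a C¹ solution on `[0,∞)`
of `-y'' + d(x) y - lam·y = g(x)`, the equation holding away from finitely many
points, with boundary condition `y'(0) = 0`. -/
def Sol1D (d : ℝ → ℝ) (lam : ℝ) (g : ℝ → ℝ) (y y' : ℝ → ℝ) : Prop :=
  (∀ x ∈ Set.Ici (0 : ℝ), HasDerivWithinAt y (y' x) (Set.Ici 0) x) ∧
  ContinuousOn y' (Set.Ici 0) ∧
  (∃ E : Finset ℝ, ∀ x ∈ Set.Ioi (0 : ℝ), x ∉ (E : Set ℝ) →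
    HasDerivAt y' (d x * y x - lam * y x - g x) x) ∧
  y' 0 = 0

/-- A bound state of the 1D Schrödinger operator `-d²/dx² + d(x)` on `(0,∞)`
with Neumann condition at `0`: a nontrivial solution decaying at `+∞`. -/
def IsBoundState1D (d : ℝ → ℝ) (lam : ℝ) (y y' : ℝ → ℝ) : Prop :=
  Sol1D d lam (fun _ => 0) y y' ∧
  Filter.Tendsto y Filter.atTop (nhds 0) ∧
  ∃ x ∈ Set.Ici (0 : ℝ), y x ≠ 0

/-- `VSol W lam y y'` : `y : ℝ → Fin 3 → ℝ` (with derivative `y'`) is a C¹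
solution on `[0,∞)` of the system `-y'' + W(x) y = lam·y`, the equation holding
away from finitely many points, with boundary condition `y'(0) = 0`. -/
def VSol (W : ℝ → Fin 3 → Fin 3 → ℝ) (lam : ℝ) (y y' : ℝ → Fin 3 → ℝ) : Prop :=
  (∀ x ∈ Set.Ici (0 : ℝ), HasDerivWithinAt y (y' x) (Set.Ici 0) x) ∧
  ContinuousOn y' (Set.Ici 0) ∧
  (∃ E : Finset ℝ, ∀ x ∈ Set.Ioi (0 : ℝ), x ∉ (E : Set ℝ) →
    HasDerivAt y' (fun i => (∑ j, W x i j * y x j) - lam * y x i) x) ∧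
  y' 0 = 0

section

theorem antitoneOn_Icc_of_hasDerivAt_nonpos_off_finset (E : Finset ℝ) {f f' : ℝ → ℝ} {a b : ℝ}
    (hf : ContinuousOn f (Icc a b))
    (hd : ∀ x ∈ Ioo a b, x ∉ E → HasDerivAt f (f' x) x)
    (hn : ∀ x ∈ Ioo a b, x ∉ E → f' x ≤ 0) : AntitoneOn f (Icc a b) := by
  induction E using Finset.induction_on generalizing a b with
  | empty =>
    refine antitoneOn_of_deriv_nonpos (convex_Icc a b) hf ?_ ?_
    · intro x hx
      rw [interior_Icc] at hx
      exact (hd x hx (by simp)).differentiableAt.differentiableWithinAt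
    · intro x hx
      rw [interior_Icc] at hx
      rw [(hd x hx (by simp)).deriv]
      exact hn x hx (by simp)
  | insert e E he ih =>
    by_cases hab : e ∈ Ioo a b
    · have h1 : AntitoneOn f (Icc a e) := by
        refine ih (hf.mono (Icc_subset_Icc_right hab.2.le)) ?_ ?_ <;>
        · intro x hx hxE
          have hx' : x ∈ Ioo a b := ⟨hx.1, hx.2.trans hab.2⟩
          have : x ∉ insert e E := by simp [hxE, hx.2.ne]
          first | exact hd x hx' this | exact hn x hx' this
      have h2 : AntitoneOn f (Icc e b) := by
        refine ih (hf.mono (Icc_subset_Icc_left hab.1.le)) ?_ ?_ <;>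
        · intro x hx hxE
          have hx' : x ∈ Ioo a b := ⟨hab.1.trans hx.1, hx.2⟩
          have : x ∉ insert e E := by simp [hxE, hx.1.ne']
          first | exact hd x hx' this | exact hn x hx' this
      have := h1.union_right h2 (isGreatest_Icc hab.1.le) (isLeast_Icc hab.2.le)
      rwa [Icc_union_Icc_eq_Icc hab.1.le hab.2.le] at this
    · refine ih hf ?_ ?_ <;>
      · intro x hx hxE
        have : x ∉ insert e E := by
          simp only [Finset.mem_insert, not_or]
          exact ⟨fun h => hab (h ▸ hx), hxE⟩
        first | exact hd x hx this | exact hn x hx this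

theorem eq_of_hasDerivAt_zero_off_finset (E : Finset ℝ) {f : ℝ → ℝ} {a b : ℝ} (hab : a ≤ b)
    (hf : ContinuousOn f (Icc a b))
    (hd : ∀ x ∈ Ioo a b, x ∉ E → HasDerivAt f 0 x) : f b = f a := by
  refine le_antisymm ?_ ?_
  · exact antitoneOn_Icc_of_hasDerivAt_nonpos_off_finset E hf hd (fun _ _ _ => le_rfl)
      ⟨le_rfl, hab⟩ ⟨hab, le_rfl⟩ hab
  · have := antitoneOn_Icc_of_hasDerivAt_nonpos_off_finset E (f := fun x => - f x)
      (f' := fun _ => 0) hf.neg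
      (fun x hx hxE => (hd x hx hxE).neg.congr_deriv neg_zero) (fun _ _ _ => le_rfl)
      ⟨le_rfl, hab⟩ ⟨hab, le_rfl⟩ hab
    linarith

theorem eq_zero_of_second_order_ode (E : Finset ℝ) {y w q : ℝ → ℝ} {a b x₀ C : ℝ}
    (hq : ∀ x ∈ Ioo a b, |q x| ≤ C)
    (hy : ContinuousOn y (Icc a b)) (hw : ContinuousOn w (Icc a b))
    (hyd : ∀ x ∈ Ioo a b, HasDerivAt y (w x) x)
    (hwd : ∀ x ∈ Ioo a b, x ∉ E → HasDerivAt w (q x * y x) x)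
    (hx₀ : x₀ ∈ Icc a b) (hy₀ : y x₀ = 0) (hw₀ : w x₀ = 0) :
    ∀ x ∈ Icc a b, y x = 0 ∧ w x = 0 := by
  have key : ∀ K : ℝ, ∀ x ∈ Ioo a b, x ∉ E →
      HasDerivAt (fun x => (y x ^ 2 + w x ^ 2) * Real.exp (K * x))
        ((2 * (1 + q x) * (y x * w x) + K * (y x ^ 2 + w x ^ 2)) * Real.exp (K * x)) x := by
    intro K x hx hxE
    have h1 := ((hyd x hx).pow 2).add ((hwd x hx hxE).pow 2)
    have h2 : HasDerivAt (fun x => Real.exp (K * x)) (Real.exp (K * x) * K) x := by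
      simpa using ((hasDerivAt_id x).const_mul K).exp
    refine (h1.mul h2).congr_deriv ?_
    simp only [Pi.add_apply, Pi.pow_apply, Nat.cast_ofNat, Nat.add_one_sub_one, pow_one]
    ring
  have hcont : ∀ K : ℝ, ContinuousOn (fun x => (y x ^ 2 + w x ^ 2) * Real.exp (K * x))
      (Icc a b) := by
    intro K
    exact ((hy.pow 2).add (hw.pow 2)).mul (by fun_prop)
  have bound : ∀ x ∈ Ioo a b, |2 * (1 + q x) * (y x * w x)| ≤
      (1 + C) * (y x ^ 2 + w x ^ 2) := by
    intro x hx
    have h1 : |1 + q x| ≤ 1 + C := (abs_add_le _ _).trans (by simpa using hq x hx)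
    have h2 : 2 * |y x * w x| ≤ y x ^ 2 + w x ^ 2 := by
      rw [abs_mul]
      nlinarith [sq_nonneg (|y x| - |w x|), sq_abs (y x), sq_abs (w x)]
    calc |2 * (1 + q x) * (y x * w x)| = |1 + q x| * (2 * |y x * w x|) := by
          rw [abs_mul, abs_mul]; norm_num; ring
      _ ≤ _ := by gcongr; exact (abs_nonneg _).trans h1
  intro x hx
  have hfin : ∀ K : ℝ, (y x ^ 2 + w x ^ 2) * Real.exp (K * x) ≤ 0 →
      y x = 0 ∧ w x = 0 := by
    intro K h
    have h2 := Real.exp_pos (K * x)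
    have : y x ^ 2 + w x ^ 2 ≤ 0 := by
      by_contra! hc
      exact absurd h (not_le.mpr (mul_pos hc h2))
    constructor <;> nlinarith [sq_nonneg (y x), sq_nonneg (w x)]
  rcases le_total x₀ x with hle | hle
  · have := antitoneOn_Icc_of_hasDerivAt_nonpos_off_finset E (hcont (-(1 + C))) (key _)
      (fun x hx _ => mul_nonpos_of_nonpos_of_nonneg
        (by linarith [(abs_le.mp (bound x hx)).2]) (Real.exp_pos _).le) hx₀ hx hle
    simp only [hy₀, hw₀] at this
    exact hfin _ (by simpa using this)
  · have := antitoneOn_Icc_of_hasDerivAt_nonpos_off_finset E (hcont (1 + C)).neg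
      (fun x hx hxE => (key (1 + C) x hx hxE).neg)
      (fun x hx _ => neg_nonpos.mpr (mul_nonneg
        (by linarith [(abs_le.mp (bound x hx)).1]) (Real.exp_pos _).le)) hx hx₀ hle
    simp only [hy₀, hw₀, Pi.neg_apply] at this
    exact hfin (1 + C) (by simpa using this)

theorem deriv_add_mul_tail_eq_exp (E : Finset ℝ) {y w : ℝ → ℝ} {L κ : ℝ}
    (hy : ContinuousOn y (Ici L)) (hw : ContinuousOn w (Ici L))
    (hyd : ∀ x ∈ Ioi L, HasDerivAt y (w x) x)
    (hwd : ∀ x ∈ Ioi L, x ∉ E → HasDerivAt w (κ ^ 2 * y x) x) {x : ℝ} (hx : L ≤ x) :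
    w x + κ * y x = (w L + κ * y L) * Real.exp (κ * (x - L)) := by
  have h := eq_of_hasDerivAt_zero_off_finset E (a := L) (b := x)
    (f := fun x => (w x + κ * y x) * Real.exp (-κ * (x - L))) hx
    (((hw.add (continuousOn_const.mul hy)).mul (by fun_prop)).mono Icc_subset_Ici_self) ?_
  · simp only [sub_self, mul_zero, Real.exp_zero, mul_one] at h
    rw [← h, mul_assoc, ← Real.exp_add]
    simp
  · intro t ht htE
    have h2 : HasDerivAt (fun x => Real.exp (-κ * (x - L))) (Real.exp (-κ * (t - L)) * -κ) t := by
      simpa using (((hasDerivAt_id t).sub_const L).const_mul (-κ)).exp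
    refine (((hwd t ht.1 htE).add ((hyd t ht.1).const_mul κ)).mul h2).congr_deriv ?_
    simp only [Pi.add_apply]
    ring

theorem tail_eq_exp (E : Finset ℝ) {y w : ℝ → ℝ} {L κ : ℝ} (hκ : 0 < κ)
    (hy : ContinuousOn y (Ici L)) (hw : ContinuousOn w (Ici L))
    (hyd : ∀ x ∈ Ioi L, HasDerivAt y (w x) x)
    (hwd : ∀ x ∈ Ioi L, x ∉ E → HasDerivAt w (κ ^ 2 * y x) x)
    {x : ℝ} (hx : L ≤ x) :
    y x = (y L - (w L + κ * y L) / (2 * κ)) * Real.exp (-κ * (x - L)) +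
      (w L + κ * y L) / (2 * κ) * Real.exp (κ * (x - L)) := by
  have h := eq_of_hasDerivAt_zero_off_finset E (a := L) (b := x)
    (f := fun x => y x * Real.exp (κ * (x - L)) -
      (w L + κ * y L) / (2 * κ) * Real.exp (2 * κ * (x - L))) hx
    (((hy.mul (by fun_prop)).sub (by fun_prop)).mono Icc_subset_Ici_self) ?_
  · simp only [sub_self, mul_zero, Real.exp_zero, mul_one] at h
    rw [← h]
    have h1 : Real.exp (2 * κ * (x - L)) = Real.exp (κ * (x - L)) * Real.exp (κ * (x - L)) := by
      rw [← Real.exp_add]; ring_nf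
    have h2 : Real.exp (κ * (x - L)) * Real.exp (-κ * (x - L)) = 1 := by
      rw [← Real.exp_add]; simp
    rw [h1]
    linear_combination (-y x + (w L + κ * y L) / (2 * κ) * Real.exp (κ * (x - L))) * h2
  · intro t ht htE
    have h2 : HasDerivAt (fun x => Real.exp (κ * (x - L))) (Real.exp (κ * (t - L)) * κ) t := by
      simpa using (((hasDerivAt_id t).sub_const L).const_mul κ).exp
    have h3 : HasDerivAt (fun x => Real.exp (2 * κ * (x - L)))
        (Real.exp (2 * κ * (t - L)) * (2 * κ)) t := by
      simpa using (((hasDerivAt_id t).sub_const L).const_mul (2 * κ)).exp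
    refine (((hyd t ht.1).mul h2).sub
      (h3.const_mul ((w L + κ * y L) / (2 * κ)))).congr_deriv ?_
    have h4 := deriv_add_mul_tail_eq_exp E hy hw hyd hwd ht.1.le
    have h1 : Real.exp (2 * κ * (t - L)) = Real.exp (κ * (t - L)) * Real.exp (κ * (t - L)) := by
      rw [← Real.exp_add]; ring_nf
    rw [h1]
    field_simp
    linear_combination Real.exp (κ * (t - L)) * h4

theorem deriv_eq_of_tail_tendsto_zero (E : Finset ℝ) {y w : ℝ → ℝ} {L κ : ℝ} (hκ : 0 < κ)
    (hy : ContinuousOn y (Ici L)) (hw : ContinuousOn w (Ici L))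
    (hyd : ∀ x ∈ Ioi L, HasDerivAt y (w x) x)
    (hwd : ∀ x ∈ Ioi L, x ∉ E → HasDerivAt w (κ ^ 2 * y x) x)
    (h0 : Tendsto y atTop (nhds 0)) : w L = -κ * y L := by
  set A := (w L + κ * y L) / (2 * κ) with hA
  have hlin : Tendsto (fun x : ℝ => κ * (x - L)) atTop atTop :=
    (tendsto_atTop_add_const_right _ (-L) tendsto_id).const_mul_atTop hκ
  have hdec : Tendsto (fun x : ℝ => Real.exp (-κ * (x - L))) atTop (nhds 0) := by
    have := Real.tendsto_exp_neg_atTop_nhds_zero.comp hlin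
    refine this.congr fun x => ?_
    simp
  have h1 : Tendsto (fun x => y x * Real.exp (-κ * (x - L)) -
      (y L - A) * (Real.exp (-κ * (x - L)) * Real.exp (-κ * (x - L)))) atTop (nhds 0) := by
    simpa using (h0.mul hdec).sub ((hdec.mul hdec).const_mul (y L - A))
  have h2 : Tendsto (fun x => y x * Real.exp (-κ * (x - L)) -
      (y L - A) * (Real.exp (-κ * (x - L)) * Real.exp (-κ * (x - L)))) atTop (nhds A) := by
    refine tendsto_const_nhds.congr' ?_
    filter_upwards [eventually_ge_atTop L] with x hx
    rw [tail_eq_exp E hκ hy hw hyd hwd hx]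
    have h2 : Real.exp (κ * (x - L)) * Real.exp (-κ * (x - L)) = 1 := by
      rw [← Real.exp_add]; simp
    linear_combination (-A) * h2
  have h3 : A = 0 := tendsto_nhds_unique h2 h1
  rw [hA, div_eq_zero_iff] at h3
  rcases h3 with h3 | h3
  · linarith
  · linarith

end

section

open scoped BoundedContinuousFunction

variable {E : Type*} [NormedAddCommGroup E] [NormedSpace ℝ E]

theorem intervalIntegrable_clm_apply {B : ℝ → E →L[ℝ] E}
    (hB : AEStronglyMeasurable B volume) {C : ℝ} (hC : ∀ t, ‖B t‖ ≤ C) {z : ℝ → E}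
    (hz : Continuous z) (a b : ℝ) : IntervalIntegrable (fun t => B t (z t)) volume a b := by
  have hzi : IntervalIntegrable (fun t => C * ‖z t‖) volume a b :=
    (by fun_prop : Continuous fun t => C * ‖z t‖).intervalIntegrable a b
  refine hzi.mono_fun ?_ (Eventually.of_forall fun t => ?_)
  · have := (isBoundedBilinearMap_apply (𝕜 := ℝ) (E := E) (F := E)).continuous.comp_aestronglyMeasurable
      (hB.prodMk hz.aestronglyMeasurable)
    exact this.restrict
  · calc ‖B t (z t)‖ ≤ ‖B t‖ * ‖z t‖ := (B t).le_opNorm _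
      _ ≤ C * ‖z t‖ := by gcongr; exact hC t
      _ ≤ _ := Real.le_norm_self _

theorem norm_weighted_integral_le {C k : ℝ} (hk : 0 < k) {g : ℝ → E} {M x : ℝ} (hx : 0 ≤ x)
    (hCM : 0 ≤ C * M)
    (hg : ∀ t ∈ Ioc 0 x, ‖g t‖ ≤ C * M * Real.exp (k * t)) :
    ‖Real.exp (-k * x) • ∫ t in (0 : ℝ)..x, g t‖ ≤ C / k * M := by
  have h1 : ‖∫ t in (0 : ℝ)..x, g t‖ ≤ ∫ t in (0 : ℝ)..x, C * M * Real.exp (k * t) := by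
    refine intervalIntegral.norm_integral_le_of_norm_le hx (Eventually.of_forall hg) ?_
    exact (by fun_prop : Continuous fun t => C * M * Real.exp (k * t)).intervalIntegrable _ _
  have h2 : ∫ t in (0 : ℝ)..x, C * M * Real.exp (k * t) = C * M * ((Real.exp (k * x) - 1) / k) := by
    rw [intervalIntegral.integral_const_mul, intervalIntegral.integral_comp_mul_left _ hk.ne']
    simp [integral_exp]
    ring_nf
    simp
  rw [norm_smul, Real.norm_of_nonneg (Real.exp_pos _).le]
  calc Real.exp (-k * x) * ‖∫ t in (0 : ℝ)..x, g t‖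
      ≤ Real.exp (-k * x) * (C * M * ((Real.exp (k * x) - 1) / k)) := by
        rw [← h2]; gcongr
    _ = C * M / k * (1 - Real.exp (-k * x)) := by
        have : Real.exp (-k * x) * Real.exp (k * x) = 1 := by rw [← Real.exp_add]; simp
        rw [div_mul_eq_mul_div, ← mul_div_assoc, ← mul_div_assoc]
        congr 1
        linear_combination C * M * this
    _ ≤ C * M / k * 1 := by
        gcongr
        linarith [Real.exp_pos (-k * x)]
    _ = _ := by ring

theorem exists_volterra_operator {B : ℝ → E →L[ℝ] E}
    (hB : AEStronglyMeasurable B volume) {C : ℝ} (hC : ∀ t, ‖B t‖ ≤ C) {k : ℝ} (hk : 0 < k) :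
    ∃ T : (ℝ →ᵇ E) →L[ℝ] (ℝ →ᵇ E), ‖T‖ ≤ C / k ∧ ∀ z x, 0 ≤ x →
      T z x = Real.exp (-k * x) • ∫ t in (0 : ℝ)..x, B t (Real.exp (k * t) • z t) := by
  have hC0 : 0 ≤ C := (norm_nonneg _).trans (hC 0)
  have hint : ∀ (z : ℝ →ᵇ E) (a b : ℝ),
      IntervalIntegrable (fun t => B t (Real.exp (k * t) • z t)) volume a b := fun z a b =>
    intervalIntegrable_clm_apply hB hC (by fun_prop) a b
  have hbd : ∀ (z : ℝ →ᵇ E) (x : ℝ), ‖Real.exp (-k * max 0 x) •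
      ∫ t in (0 : ℝ)..(max 0 x), B t (Real.exp (k * t) • z t)‖ ≤ C / k * ‖z‖ := by
    intro z x
    refine norm_weighted_integral_le hk (le_max_left _ _) (by positivity) fun t _ => ?_
    calc ‖B t (Real.exp (k * t) • z t)‖ ≤ ‖B t‖ * ‖Real.exp (k * t) • z t‖ := (B t).le_opNorm _
      _ = ‖B t‖ * (Real.exp (k * t) * ‖z t‖) := by
        rw [norm_smul, Real.norm_of_nonneg (Real.exp_pos _).le]
      _ ≤ C * (Real.exp (k * t) * ‖z‖) := by
        gcongr
        · exact hC t
        · exact z.norm_coe_le_norm t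
      _ = _ := by ring
  let f : (ℝ →ᵇ E) → (ℝ →ᵇ E) := fun z => BoundedContinuousFunction.ofNormedAddCommGroup
    (fun x => Real.exp (-k * max 0 x) •
      ∫ t in (0 : ℝ)..(max 0 x), B t (Real.exp (k * t) • z t)) (by
        have h1 := intervalIntegral.continuous_primitive (hint z) 0
        have h2 : Continuous fun x : ℝ => max 0 x := by fun_prop
        exact (by fun_prop : Continuous fun x : ℝ => Real.exp (-k * max 0 x)).smul (h1.comp h2))
      (C / k * ‖z‖) (hbd z)
  have hf : ∀ z x, f z x = Real.exp (-k * max 0 x) •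
      ∫ t in (0 : ℝ)..(max 0 x), B t (Real.exp (k * t) • z t) := fun _ _ => rfl
  let T₀ : (ℝ →ᵇ E) →ₗ[ℝ] (ℝ →ᵇ E) :=
    { toFun := f
      map_add' := by
        intro z z'
        ext x
        simp only [hf, BoundedContinuousFunction.coe_add, Pi.add_apply, smul_add, map_add]
        rw [intervalIntegral.integral_add (hint z _ _) (hint z' _ _), smul_add]
      map_smul' := by
        intro c z
        ext x
        simp only [hf, BoundedContinuousFunction.coe_smul, RingHom.id_apply]
        simp only [smul_comm _ c, map_smul, intervalIntegral.integral_smul] }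
  refine ⟨T₀.mkContinuous (C / k) fun z => ?_, ?_, ?_⟩
  · rw [BoundedContinuousFunction.norm_le (by positivity)]
    exact hbd z
  · exact LinearMap.mkContinuous_norm_le _ (by positivity) _
  · intro z x hx
    change f z x = _
    rw [hf, max_eq_right hx]

theorem exists_cauchy_solution_family [CompleteSpace E] {ι : Type*} [Fintype ι] {B₀ : ℝ → E →L[ℝ] E}
    {B : ι → ℝ → E →L[ℝ] E} (hB₀ : AEStronglyMeasurable B₀ volume)
    (hB : ∀ i, AEStronglyMeasurable (B i) volume) {C : ℝ} (hC₀ : ∀ t, ‖B₀ t‖ ≤ C)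
    (hC : ∀ i t, ‖B i t‖ ≤ C) :
    ∃ (k : ℝ) (Z : (ι → ℝ) × E → ℝ →ᵇ E),
      (∀ c, ContDiffAt ℝ 1 Z (0, c)) ∧
      ∀ᶠ p in nhds (0 : ι → ℝ), ∀ c x, 0 ≤ x →
        Real.exp (k * x) • Z (p, c) x = c + ∫ t in (0 : ℝ)..x,
          (B₀ t + ∑ i, p i • B i t) (Real.exp (k * t) • Z (p, c) t) := by
  have hC0 : 0 ≤ C := (norm_nonneg _).trans (hC₀ 0)
  set k : ℝ := C + 1 with hkdef
  have hk : 0 < k := by positivity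
  obtain ⟨T₀, hT₀n, hT₀⟩ := exists_volterra_operator hB₀ hC₀ hk
  choose T hTn hT using fun i => exists_volterra_operator (hB i) (hC i) hk
  have hT₀lt : ‖T₀‖ < 1 := hT₀n.trans_lt (by rw [div_lt_one hk]; linarith)
  have hbd : ∀ (c : E) (x : ℝ), ‖Real.exp (-k * max 0 x) • c‖ ≤ 1 * ‖c‖ := by
    intro c x
    rw [norm_smul, Real.norm_of_nonneg (Real.exp_pos _).le]
    gcongr
    rw [Real.exp_le_one_iff]
    nlinarith [le_max_left 0 x]
  let j₀ : E →ₗ[ℝ] (ℝ →ᵇ E) :=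
    { toFun := fun c => BoundedContinuousFunction.ofNormedAddCommGroup
        (fun x => Real.exp (-k * max 0 x) • c) (by fun_prop) (1 * ‖c‖) (hbd c)
      map_add' := fun c c' => by ext x; simp
      map_smul' := fun a c => by ext x; simp [smul_comm a] }
  let j : E →L[ℝ] (ℝ →ᵇ E) := j₀.mkContinuous 1 fun c => by
    rw [BoundedContinuousFunction.norm_le (by positivity)]
    exact hbd c
  have hj : ∀ c x, 0 ≤ x → j c x = Real.exp (-k * x) • c := by
    intro c x hx
    change Real.exp (-k * max 0 x) • c = _
    rw [max_eq_right hx]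
  let R : (ι → ℝ) → (ℝ →ᵇ E) →L[ℝ] (ℝ →ᵇ E) := fun p => 1 - (T₀ + ∑ i, p i • T i)
  have hR : ContDiff ℝ 1 R := by fun_prop
  let u : ((ℝ →ᵇ E) →L[ℝ] (ℝ →ᵇ E))ˣ := Units.oneSub T₀ hT₀lt
  have hu : R 0 = u := by simp [R, u]
  refine ⟨k, fun q => Ring.inverse (R q.1) (j q.2), ?_, ?_⟩
  · intro c
    have h1 : ContDiffAt ℝ 1 (fun q : (ι → ℝ) × E => Ring.inverse (R q.1)) (0, c) := by
      have h2 : ContDiffAt ℝ 1 Ring.inverse (R ((0, c) : (ι → ℝ) × E).1) := by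
        simp only [hu]
        exact contDiffAt_ringInverse ℝ u
      exact h2.comp (f := fun q : (ι → ℝ) × E => R q.1) _ (hR.comp contDiff_fst).contDiffAt
    exact h1.clm_apply (by fun_prop)
  · have hunit : ∀ᶠ p in nhds (0 : ι → ℝ), IsUnit (R p) :=
      hR.continuous.continuousAt.eventually (by rw [hu]; exact u.nhds)
    filter_upwards [hunit] with p hp c x hx
    set z := Ring.inverse (R p) (j c) with hz
    have h1 : R p z = j c := by
      have := Ring.mul_inverse_cancel (R p) hp
      rw [hz, ← mul_apply_eq_comp, this]
      rfl
    have h2 : z x = j c x + (T₀ z x + ∑ i, p i • T i z x) := by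
      rw [← h1]
      simp [R, BoundedContinuousFunction.coe_sum]
    have hint : ∀ {B' : ℝ → E →L[ℝ] E} (_ : AEStronglyMeasurable B' volume)
        (_ : ∀ t, ‖B' t‖ ≤ C),
        IntervalIntegrable (fun t => B' t (Real.exp (k * t) • z t)) volume 0 x := fun h h' =>
      intervalIntegrable_clm_apply h h' (by fun_prop) _ _
    have h3 : Real.exp (k * x) * Real.exp (-k * x) = 1 := by rw [← Real.exp_add]; simp
    rw [h2, hj c x hx, hT₀ z x hx]
    have h4 : ∀ v : E, Real.exp (k * x) • Real.exp (-k * x) • v = v := fun v => by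
      rw [smul_smul, h3, one_smul]
    simp only [hT _ z x hx, smul_add, Finset.smul_sum, smul_comm (p _) (Real.exp _), h4]
    congr 1
    simp only [add_apply, sum_apply, smul_apply]
    rw [intervalIntegral.integral_add (hint hB₀ hC₀), intervalIntegral.integral_finsetSum]
    · simp
    · exact fun i _ => (hint (hB i) (hC i)).smul (p i)
    · have := IntervalIntegrable.sum Finset.univ
        (f := fun i t => p i • B i t (Real.exp (k * t) • z t))
        (fun i _ => (hint (hB i) (hC i)).smul (p i))
      simpa [Finset.sum_fn] using this

theorem exists_integral_functional {f : ℝ → ℝ} {L : ℝ} (hL : 0 ≤ L)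
    (hf : IntervalIntegrable f volume 0 L) (S : E →L[ℝ] ℝ) (k : ℝ) :
    ∃ ℓ : (ℝ →ᵇ E) →L[ℝ] ℝ, ∀ z : ℝ →ᵇ E,
      ℓ z = ∫ t in (0 : ℝ)..L, f t * S (Real.exp (k * t) • z t) := by
  have hint : ∀ z : ℝ →ᵇ E,
      IntervalIntegrable (fun t => f t * S (Real.exp (k * t) • z t)) volume 0 L := fun z =>
    hf.mul_continuousOn (by fun_prop)
  let ℓ₀ : (ℝ →ᵇ E) →ₗ[ℝ] ℝ :=
    { toFun := fun z => ∫ t in (0 : ℝ)..L, f t * S (Real.exp (k * t) • z t)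
      map_add' := fun z z' => by
        rw [← intervalIntegral.integral_add (hint z) (hint z')]
        congr 1
        ext t
        simp [mul_add]
      map_smul' := fun a z => by
        rw [RingHom.id_apply, smul_eq_mul, ← intervalIntegral.integral_const_mul]
        congr 1
        ext t
        simp only [BoundedContinuousFunction.coe_smul, map_smul, smul_eq_mul]
        ring }
  refine ⟨ℓ₀.mkContinuous (∫ t in (0 : ℝ)..L, |f t| * (‖S‖ * Real.exp (|k| * L))) fun z => ?_,
    fun z => rfl⟩
  change ‖∫ t in (0 : ℝ)..L, f t * S (Real.exp (k * t) • z t)‖ ≤ _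
  rw [← intervalIntegral.integral_mul_const]
  refine intervalIntegral.norm_integral_le_of_norm_le hL (Eventually.of_forall fun t ht => ?_) ?_
  · rw [norm_mul, Real.norm_eq_abs, mul_assoc]
    have ht0 := ht.1.le
    gcongr
    calc ‖S (Real.exp (k * t) • z t)‖ ≤ ‖S‖ * ‖Real.exp (k * t) • z t‖ := S.le_opNorm _
      _ = ‖S‖ * (Real.exp (k * t) * ‖z t‖) := by
        rw [norm_smul, Real.norm_of_nonneg (Real.exp_pos _).le]
      _ ≤ ‖S‖ * (Real.exp (|k| * L) * ‖z‖) := by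
        gcongr
        · exact le_abs_self k
        · exact ht.2
        · exact z.norm_coe_le_norm t
      _ = _ := by ring
  · exact (hf.abs.mul_const _).mul_const _

end

section

open scoped BoundedContinuousFunction

theorem aestronglyMeasurable_of_continuousAt_off_finset {X : Type*} [TopologicalSpace X]
    [TopologicalSpace.PseudoMetrizableSpace X] [SecondCountableTopology X]
    (S : Finset ℝ) {f : ℝ → X} (hf : ∀ x ∉ S, ContinuousAt f x) :
    AEStronglyMeasurable f volume := by
  have h1 : ContinuousOn f ((S : Set ℝ)ᶜ) := fun x hx => (hf x (by simpa using hx)).continuousWithinAt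
  have h2 := h1.aestronglyMeasurable (μ := volume) S.measurableSet.compl
  have h3 : volume.restrict ((S : Set ℝ)ᶜ) = volume := by
    rw [Measure.restrict_eq_self_of_ae_mem]
    have : volume (S : Set ℝ) = 0 := S.finite_toSet.measure_zero _
    exact measure_eq_zero_iff_ae_notMem.mp this
  rwa [h3] at h2

section SecondOrder

variable {m : Type*} [Fintype m]

/-- The matrix `Q` acting as `(y, w) ↦ (0, Q y)`. -/
def lowerBlock : (m → m → ℝ) →L[ℝ] ((m → ℝ) × (m → ℝ)) →L[ℝ] ((m → ℝ) × (m → ℝ)) :=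
  LinearMap.toContinuousLinearMap
    { toFun := fun Q => LinearMap.toContinuousLinearMap
        { toFun := fun Y => (0, fun i => ∑ j, Q i j * Y.1 j)
          map_add' := fun Y Y' => by ext i <;> simp [mul_add, Finset.sum_add_distrib]
          map_smul' := fun a Y => by ext i <;> simp [Finset.mul_sum, mul_left_comm] }
      map_add' := fun Q Q' => by ext Y i <;> simp [add_mul, Finset.sum_add_distrib]
      map_smul' := fun a Q => by ext Y i <;> simp [Finset.mul_sum, mul_assoc] }

theorem lowerBlock_apply (Q : m → m → ℝ) (Y : (m → ℝ) × (m → ℝ)) :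
    lowerBlock Q Y = (0, fun i => ∑ j, Q i j * Y.1 j) := rfl

theorem exists_second_order_solution_family {ι : Type*} [Fintype ι] (S : Finset ℝ)
    {Q₀ : ℝ → m → m → ℝ} {Q : ι → ℝ → m → m → ℝ} {C : ℝ}
    (hQ₀ : ∀ x ∉ S, ContinuousAt Q₀ x) (hQ : ∀ a, ∀ x ∉ S, ContinuousAt (Q a) x)
    (hC₀ : ∀ x i j, |Q₀ x i j| ≤ C) (hC : ∀ a x i j, |Q a x i j| ≤ C) (hC0 : 0 ≤ C) :
    ∃ (k : ℝ) (Z : (ι → ℝ) × (m → ℝ) → ℝ →ᵇ ((m → ℝ) × (m → ℝ))),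
      (∀ c, ContDiffAt ℝ 1 Z (0, c)) ∧
      ∀ᶠ p in nhds (0 : ι → ℝ), ∀ c,
        (∀ x ∈ Ici (0 : ℝ), HasDerivWithinAt (fun x => Real.exp (k * x) • (Z (p, c) x).1)
          (Real.exp (k * x) • (Z (p, c) x).2) (Ici 0) x) ∧
        (∀ x ∈ Ioi (0 : ℝ), x ∉ S → HasDerivAt (fun x => Real.exp (k * x) • (Z (p, c) x).2)
          (fun i => ∑ j, (Q₀ x i j + ∑ a, p a * Q a x i j) * (Real.exp (k * x) • (Z (p, c) x).1) j)
          x) ∧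
        (Z (p, c) 0).2 = 0 ∧ (Z (p, c) 0).1 = c := by
  let N : ((m → ℝ) × (m → ℝ)) →L[ℝ] ((m → ℝ) × (m → ℝ)) :=
    (ContinuousLinearMap.inl ℝ _ _).comp (ContinuousLinearMap.snd ℝ _ _)
  have hnorm : ∀ P : m → m → ℝ, (∀ i j, |P i j| ≤ C) →
      ‖lowerBlock P‖ ≤ ‖lowerBlock (m := m)‖ * C := fun P hP => by
    refine (lowerBlock.le_opNorm P).trans ?_
    gcongr
    refine (pi_norm_le_iff_of_nonneg hC0).mpr fun i => (pi_norm_le_iff_of_nonneg hC0).mpr fun j =>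
      hP i j
  have hcb : ∀ {P : ℝ → m → m → ℝ} {x : ℝ}, ContinuousAt P x →
      ContinuousAt (fun x => lowerBlock (P x)) x := fun h =>
    lowerBlock.continuous.continuousAt.comp h
  have hcb₀ : ∀ x ∉ S, ContinuousAt (fun x => N + lowerBlock (Q₀ x)) x := fun x hx =>
    continuousAt_const.add (hcb (hQ₀ x hx))
  obtain ⟨k, Z, hZ, hsol⟩ := exists_cauchy_solution_family
    (B₀ := fun x => N + lowerBlock (Q₀ x)) (B := fun a x => lowerBlock (Q a x))
    (C := ‖N‖ + ‖lowerBlock (m := m)‖ * C)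
    (aestronglyMeasurable_of_continuousAt_off_finset S hcb₀)
    (fun a => aestronglyMeasurable_of_continuousAt_off_finset S fun x hx => hcb (hQ a x hx))
    (fun x => (norm_add_le _ _).trans (by gcongr; exact hnorm _ (hC₀ x)))
    (fun a x => (hnorm _ (hC a x)).trans (le_add_of_nonneg_left (norm_nonneg _)))
  refine ⟨k, fun q => Z (q.1, (q.2, 0)), fun c => ?_, ?_⟩
  · exact (hZ (c, 0)).comp (f := fun q : (ι → ℝ) × (m → ℝ) => (q.1, (q.2, (0 : m → ℝ)))) (0, c)
      (by fun_prop)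
  filter_upwards [hsol] with p hp c
  set Y : ℝ → (m → ℝ) × (m → ℝ) := fun x => Real.exp (k * x) • Z (p, (c, 0)) x with hY
  have hYc : Continuous Y := by fun_prop
  set A : ℝ → ((m → ℝ) × (m → ℝ)) →L[ℝ] ((m → ℝ) × (m → ℝ)) := fun t =>
    N + lowerBlock (Q₀ t) + ∑ a, p a • lowerBlock (Q a t) with hA
  have hAc : ∀ x ∉ S, ContinuousAt A x := fun x hx =>
    (hcb₀ x hx).add (tendsto_finsetSum _ fun a _ => (hcb (hQ a x hx)).const_smul (p a))
  have hAm := aestronglyMeasurable_of_continuousAt_off_finset S hAc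
  have hAb : ∀ t, ‖A t‖ ≤ ‖N‖ + ‖lowerBlock (m := m)‖ * C +
      ∑ a, |p a| * (‖lowerBlock (m := m)‖ * C) := fun t => by
    refine (norm_add_le _ _).trans ?_
    gcongr
    · exact (norm_add_le _ _).trans (by gcongr; exact hnorm _ (hC₀ t))
    · refine (norm_sum_le _ _).trans (Finset.sum_le_sum fun a _ => ?_)
      rw [norm_smul, Real.norm_eq_abs]
      gcongr
      exact hnorm _ (hC a t)
  have hint : ∀ a b, IntervalIntegrable (fun t => A t (Y t)) volume a b :=
    intervalIntegrable_clm_apply hAm hAb hYc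
  have hAY : ∀ t, A t (Y t) = ((Y t).2, fun i =>
      ∑ j, (Q₀ t i j + ∑ a, p a * Q a t i j) * (Y t).1 j) := fun t => by
    have : A t = N + lowerBlock (fun i j => Q₀ t i j + ∑ a, p a * Q a t i j) := by
      have h1 : (fun i j => Q₀ t i j + ∑ a, p a * Q a t i j) = Q₀ t + ∑ a, p a • Q a t := by
        ext i j
        simp [Finset.sum_apply]
      rw [h1, map_add, map_sum]
      simp [hA, add_assoc]
    rw [this, add_apply, lowerBlock_apply]
    simp [N]
  have hYeq : ∀ x, 0 ≤ x → Y x = (c, 0) + ∫ t in (0 : ℝ)..x, A t (Y t) := fun x hx =>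
    hp (c, 0) x hx
  have h1eq : ∀ x, 0 ≤ x → (Y x).1 = c + ∫ t in (0 : ℝ)..x, (Y t).2 := fun x hx => by
    have h := (ContinuousLinearMap.fst ℝ (m → ℝ) (m → ℝ)).intervalIntegral_comp_comm (hint 0 x)
    have h' := congrArg Prod.fst (hYeq x hx)
    rw [h', Prod.fst_add, ← ContinuousLinearMap.coe_fst' (R := ℝ), ← h]
    simp [hAY]
  have hFTC : ∀ x, HasDerivAt (fun x => c + ∫ t in (0 : ℝ)..x, (Y t).2) (Y x).2 x := fun x =>
    (intervalIntegral.integral_hasDerivAt_right (by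
      exact (by fun_prop : Continuous fun t => (Y t).2).intervalIntegrable _ _)
      ((by fun_prop : Continuous fun t => (Y t).2).stronglyMeasurableAtFilter _ _)
      (by fun_prop)).const_add c
  have h0 := hYeq 0 le_rfl
  simp only [intervalIntegral.integral_same, add_zero, hY, mul_zero, Real.exp_zero, one_smul] at h0
  refine ⟨fun x hx => ?_, fun x hx hxS => ?_, by rw [h0], by rw [h0]⟩
  · exact (hFTC x).hasDerivWithinAt.congr (fun t ht => h1eq t ht) (h1eq x hx)
  · have hc : ContinuousAt (fun t => A t (Y t)) x :=
      (hAc x hxS).clm_apply hYc.continuousAt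
    have h1 : HasDerivAt (fun x => (c, (0 : m → ℝ)) + ∫ t in (0 : ℝ)..x, A t (Y t))
        (A x (Y x)) x :=
      (intervalIntegral.integral_hasDerivAt_right (hint 0 x)
        ⟨univ, univ_mem, ((isBoundedBilinearMap_apply (𝕜 := ℝ)).continuous.comp_aestronglyMeasurable
          (hAm.prodMk hYc.aestronglyMeasurable)).restrict⟩ hc).const_add _
    have h2 : HasDerivAt Y (A x (Y x)) x := by
      refine h1.congr_of_eventuallyEq ?_
      filter_upwards [lt_mem_nhds hx] with t ht
      exact hYeq t ht.le
    rw [hAY] at h2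
    exact h2.snd

end SecondOrder

end

section

theorem exists_zero_near_of_surjective_partial_deriv {X Y : Type*} [NormedAddCommGroup X]
    [NormedSpace ℝ X] [CompleteSpace X] [NormedAddCommGroup Y] [NormedSpace ℝ Y] [CompleteSpace Y]
    {H : X × ℝ → Y} {x₀ : X} (hH : ContDiffAt ℝ 1 H (x₀, 0)) (h0 : H (x₀, 0) = 0)
    (hsurj : ∀ y, ∃ w, HasDerivAt (fun t : ℝ => H (x₀ + t • w, 0)) y 0)
    {P : X × ℝ → Prop} (hP : ∀ᶠ v in nhds (x₀, 0), P v) :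
    ∃ δ₀ > 0, ∀ δ : ℝ, |δ| < δ₀ → ∃ x, P (x, δ) ∧ H (x, δ) = 0 := by
  have hs := hH.hasStrictFDerivAt one_ne_zero
  set H' := fderiv ℝ H (x₀, 0)
  have hG : HasStrictFDerivAt (fun v : X × ℝ => (H v, v.2))
      (H'.prod (ContinuousLinearMap.snd ℝ X ℝ)) (x₀, 0) := hs.prodMk hasStrictFDerivAt_snd
  have hr : (H'.prod (ContinuousLinearMap.snd ℝ X ℝ)).range = ⊤ := by
    rw [LinearMap.range_eq_top]
    rintro ⟨y, d⟩
    obtain ⟨w, hw⟩ := hsurj (y - H' (0, d))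
    have h1 : HasDerivAt (fun t : ℝ => (x₀ + t • w, (0 : ℝ))) (w, 0) 0 := by
      have : HasDerivAt (fun t : ℝ => x₀ + t • w) ((1 : ℝ) • w) 0 :=
        ((hasDerivAt_id (0 : ℝ)).smul_const w).const_add x₀
      rw [one_smul] at this
      exact this.prodMk (hasDerivAt_const _ _)
    have h2 : HasFDerivAt H H' ((fun t : ℝ => (x₀ + t • w, (0 : ℝ))) 0) := by
      simpa using hs.hasFDerivAt
    have h3 := (HasFDerivAt.comp_hasDerivAt (f := fun t : ℝ => (x₀ + t • w, (0 : ℝ))) 0 h2 h1).unique hw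
    refine ⟨(w, d), ?_⟩
    have h4 : ((w, d) : X × ℝ) = (w, 0) + (0, d) := by simp
    change (H' (w, d), d) = (y, d)
    rw [h4, map_add, h3]
    simp
  have hm := hG.map_nhds_eq_of_surj hr
  simp only [h0] at hm
  have h5 : ∀ᶠ u in nhds ((0 : Y), (0 : ℝ)), ∃ v, P v ∧ (H v, v.2) = u := by
    rw [← hm, eventually_map]
    filter_upwards [hP] with v hv
    exact ⟨v, hv, rfl⟩
  have h6 : ∀ᶠ d in nhds (0 : ℝ), ∃ v, P v ∧ (H v, v.2) = (0, d) :=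
    (by fun_prop : Continuous fun d : ℝ => ((0 : Y), d)).continuousAt.eventually h5
  obtain ⟨δ₀, hδ₀, hball⟩ := Metric.eventually_nhds_iff.mp h6
  refine ⟨δ₀, hδ₀, fun δ hδ => ?_⟩
  obtain ⟨⟨x, d⟩, hv, he⟩ := hball (by simpa using hδ)
  obtain ⟨h7, h8⟩ := Prod.mk.inj he
  simp only at h8
  subst h8
  exact ⟨x, hv, h7⟩

theorem wronskian_eq_integral (E : Finset ℝ) {L : ℝ} (hL : 0 ≤ L) {u u' y y' q r : ℝ → ℝ}
    (hu : ContinuousOn u (Icc 0 L)) (hu' : ContinuousOn u' (Icc 0 L))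
    (hy : ContinuousOn y (Icc 0 L)) (hy' : ContinuousOn y' (Icc 0 L))
    (hud : ∀ x ∈ Ioo 0 L, HasDerivAt u (u' x) x) (hyd : ∀ x ∈ Ioo 0 L, HasDerivAt y (y' x) x)
    (hud' : ∀ x ∈ Ioo 0 L, x ∉ E → HasDerivAt u' (q x * u x) x)
    (hyd' : ∀ x ∈ Ioo 0 L, x ∉ E → HasDerivAt y' (q x * y x + r x) x)
    (hr : IntervalIntegrable (fun x => u x * r x) volume 0 L)
    (hu0 : u' 0 = 0) (hy0 : y' 0 = 0) :
    u L * y' L - u' L * y L = ∫ x in (0 : ℝ)..L, u x * r x := by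
  have := integral_eq_of_hasDerivAt_off_countable_of_le (fun x => u x * y' x - u' x * y x)
    (fun x => u x * r x) hL E.countable_toSet ((hu.mul hy').sub (hu'.mul hy)) ?_ hr
  · rw [this]
    simp [hu0, hy0]
  · rintro x ⟨hx, hxE⟩
    have hxE : x ∉ E := by simpa using hxE
    refine (((hud x hx).mul (hyd' x hx hxE)).sub ((hud' x hx hxE).mul (hyd x hx))).congr_deriv ?_
    ring

theorem integral_sq_of_exp_tail {y : ℝ → ℝ} {L κ : ℝ} (hL : 0 ≤ L) (hκ : 0 < κ)
    (hy : ContinuousOn y (Icc 0 L))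
    (htail : ∀ x, L ≤ x → y x = y L * Real.exp (-κ * (x - L))) :
    ∫ x in Ioi (0 : ℝ), y x ^ 2 = (∫ x in (0 : ℝ)..L, y x ^ 2) + y L ^ 2 / (2 * κ) := by
  have h1 : ∀ x ∈ Ioi L, y x ^ 2 = y L ^ 2 * Real.exp (2 * κ * L) * Real.exp (-(2 * κ) * x) := by
    intro x hx
    rw [htail x (le_of_lt hx), mul_pow, ← Real.exp_nat_mul, mul_assoc, ← Real.exp_add]
    congr 2
    push_cast
    ring
  have h2 : IntegrableOn (fun x => y x ^ 2) (Ioi L) := by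
    have := (integrableOn_exp_mul_Ioi (a := -(2 * κ)) (by linarith) L).const_mul
      (y L ^ 2 * Real.exp (2 * κ * L))
    exact IntegrableOn.congr_fun this (fun x hx => (h1 x hx).symm) measurableSet_Ioi
  have h3 : IntegrableOn (fun x => y x ^ 2) (Ioc 0 L) :=
    ((hy.pow 2).integrableOn_Icc).mono_set Ioc_subset_Icc_self
  rw [← Ioc_union_Ioi_eq_Ioi hL, setIntegral_union (Ioc_disjoint_Ioi le_rfl) measurableSet_Ioi h3 h2,
    intervalIntegral.integral_of_le hL, setIntegral_congr_fun measurableSet_Ioi h1,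
    integral_const_mul, integral_exp_mul_Ioi (by linarith)]
  have : Real.exp (2 * κ * L) * Real.exp (-(2 * κ) * L) = 1 := by rw [← Real.exp_add]; simp
  congr 1
  rw [neg_mul] at this ⊢
  field_simp
  linear_combination (y L ^ 2) * this

theorem setIntegral_Ioi_eq_intervalIntegral {f : ℝ → ℝ} {L : ℝ} (hL : 0 ≤ L)
    (hf : ∀ x ≥ L, f x = 0) : ∫ x in Ioi (0 : ℝ), f x = ∫ x in (0 : ℝ)..L, f x := by
  rw [intervalIntegral.integral_of_le hL]
  refine setIntegral_eq_of_subset_of_forall_sdiff_eq_zero measurableSet_Ioi Ioc_subset_Ioi_self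
    fun x hx => hf x ?_
  by_contra! h
  exact hx.2 ⟨hx.1, h.le⟩

end

section

theorem intervalIntegrable_mul_of_continuousAt_off_finset (S : Finset ℝ) {q f : ℝ → ℝ} {C L : ℝ}
    (hL : 0 ≤ L) (hq : ∀ x ∉ S, ContinuousAt q x) (hC : ∀ x, |q x| ≤ C)
    (hf : ContinuousOn f (Icc 0 L)) : IntervalIntegrable (fun x => q x * f x) volume 0 L := by
  have h1 : IntervalIntegrable q volume 0 L :=
    (intervalIntegrable_const (c := C)).mono_fun
      (aestronglyMeasurable_of_continuousAt_off_finset S hq).restrict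
      (Eventually.of_forall fun x => (hC x).trans (Real.le_norm_self _))
  exact h1.mul_continuousOn (by rwa [uIcc_of_le hL])

theorem exists_reduced_crossing_solution {R : ℝ} (hR : R ≠ 0) {d n : Fin 3 → ℝ}
    {Γ : Fin 3 → Fin 3 → ℝ} (hn1 : n 1 = 1) (hn2 : n 2 = 1) (hd : d 1 ≠ d 2)
    (h1 : Γ 0 1 ≠ 0) (h2 : Γ 0 2 ≠ 0) (hΓ : ∀ j, Γ j j = 0) :
    ∃ (c₀ : Fin 3 → ℝ) (σ₀ μ₀ : ℝ), c₀ 0 = 0 ∧ c₀ 1 ≠ 0 ∧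
      (∀ j, σ₀ * c₀ j * d j - μ₀ * c₀ j * n j + ∑ k, c₀ k * Γ j k = 0) ∧
      ∀ (g₀ : ℝ) (g : Fin 3 → ℝ), ∃ (c : Fin 3 → ℝ) (σ μ : ℝ), c 0 * R = g₀ ∧
        ∀ j, (σ * c₀ j + σ₀ * c j) * d j - (μ * c₀ j + μ₀ * c j) * n j + ∑ k, c k * Γ j k
          = g j := by
  have hd' : d 1 - d 2 ≠ 0 := sub_ne_zero.mpr hd
  have solve : ∀ r₁ r₂ : ℝ, ∃ σ μ : ℝ, σ * d 1 - μ = r₁ ∧ σ * d 2 - μ = r₂ := fun r₁ r₂ => by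
    refine ⟨(r₁ - r₂) / (d 1 - d 2), (r₁ - r₂) / (d 1 - d 2) * d 1 - r₁, by ring, ?_⟩
    field_simp
    ring
  obtain ⟨σ₀, μ₀, e1, e2⟩ := solve (Γ 1 2 * Γ 0 1 / Γ 0 2) (Γ 2 1 * Γ 0 2 / Γ 0 1)
  refine ⟨![0, Γ 0 2, -Γ 0 1], σ₀, μ₀, rfl, h2, ?_, fun g₀ g => ?_⟩
  · rw [eq_div_iff h2] at e1
    rw [eq_div_iff h1] at e2
    intro j
    fin_cases j <;> simp [Fin.sum_univ_three, hΓ, hn1, hn2]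
    · ring
    · linear_combination e1
    · linear_combination -e2
  · set x : ℝ := g₀ / R with hx
    set y : ℝ := (g 0 - σ₀ * x * d 0 + μ₀ * x * n 0) / Γ 0 1 with hy
    obtain ⟨σ, μ, e3, e4⟩ := solve ((g 1 - σ₀ * y * d 1 + μ₀ * y - x * Γ 1 0) / Γ 0 2)
      (-(g 2 - x * Γ 2 0 - y * Γ 2 1) / Γ 0 1)
    rw [eq_div_iff h2] at e3
    rw [eq_div_iff h1] at e4
    rw [eq_div_iff h1] at hy
    rw [eq_div_iff hR] at hx
    refine ⟨![x, y, 0], σ, μ, by simpa using hx, fun j => ?_⟩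
    fin_cases j <;> simp [Fin.sum_univ_three, hΓ, hn1, hn2]
    · linear_combination hy
    · linear_combination e3
    · linear_combination -e4

end

section

open scoped BoundedContinuousFunction

theorem exists_matching_solution {S : Finset ℝ} {L lam₀ κ₀ CB : ℝ} {D₀ D₁ : ℝ → Fin 3 → ℝ}
    {F : ℝ → Fin 3 → Fin 3 → ℝ} {φ φ' : Fin 3 → ℝ → ℝ} (hL : 0 < L) (hlam₀ : lam₀ ∈ Ioo (0 : ℝ) 1)
    (hκ₀ : 0 < κ₀) (hκ₀sq : κ₀ ^ 2 = 1 - lam₀)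
    (hD₀c : ∀ x ∉ S, ContinuousAt D₀ x) (hD₁c : ∀ x ∉ S, ContinuousAt D₁ x)
    (hFc : ∀ x ∉ S, ContinuousAt F x)
    (hD₀b : ∀ x i, |D₀ x i| ≤ CB) (hD₁b : ∀ x i, |D₁ x i| ≤ CB) (hFb : ∀ x i j, |F x i j| ≤ CB)
    (hFdiag : ∀ x i, F x i i = 0)
    (hφ : ∀ j, ∀ x ∈ Ici (0 : ℝ), HasDerivWithinAt (φ j) (φ' j x) (Ici 0) x)
    (hφ'c : ∀ j, ContinuousOn (φ' j) (Ici 0))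
    (hφ' : ∀ j, ∀ x ∈ Ioi (0 : ℝ), x ∉ S → HasDerivAt (φ' j) ((D₀ x j - lam₀) * φ j x) x)
    (hφ'0 : ∀ j, φ' j 0 = 0)
    (hφL : ∀ j, j ≠ 0 → φ' j L = -κ₀ * φ j L) (hφL0 : ∀ j, j ≠ 0 → φ j L ≠ 0)
    (hR : φ 0 L ^ 2 + φ' 0 L ^ 2 ≠ 0)
    (hnorm : ∀ j, j ≠ 0 → (∫ x in (0 : ℝ)..L, φ j x ^ 2) + φ j L ^ 2 / (2 * κ₀) = 1)
    (hd : (∫ x in (0 : ℝ)..L, D₁ x 1 * φ 1 x ^ 2) ≠ ∫ x in (0 : ℝ)..L, D₁ x 2 * φ 2 x ^ 2)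
    (h1 : (∫ x in (0 : ℝ)..L, φ 0 x * (F x 0 1 * φ 1 x)) ≠ 0)
    (h2 : (∫ x in (0 : ℝ)..L, φ 0 x * (F x 0 2 * φ 2 x)) ≠ 0) {ε : ℝ} (hε : 0 < ε) :
    ∃ δ₀ > 0, ∀ δ : ℝ, |δ| < δ₀ → ∃ s lam : ℝ, |s| < ε ∧ |lam - lam₀| < ε ∧ lam ∈ Ioo (0 : ℝ) 1 ∧
      ∃ y w : ℝ → Fin 3 → ℝ,
        (∀ x ∈ Ici (0 : ℝ), HasDerivWithinAt y (w x) (Ici 0) x) ∧ Continuous w ∧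
        (∀ x ∈ Ioi (0 : ℝ), x ∉ S → HasDerivAt w (fun i => (∑ j, ((if i = j then
          D₀ x i + s * D₁ x i else 0) + δ * F x i j) * y x j) - lam * y x i) x) ∧
        w 0 = 0 ∧ y L ≠ 0 ∧ y L 0 = 0 ∧ w L 0 = 0 ∧
        ∀ j, j ≠ 0 → w L j = -Real.sqrt (1 - lam) * y L j := by
  have hCB : 0 ≤ CB := (abs_nonneg _).trans (hD₀b 0 0)
  have hφc : ∀ j, ContinuousOn (φ j) (Ici 0) := fun j x hx => (hφ j x hx).continuousWithinAt
  have hIcc : Icc 0 L ⊆ Ici (0 : ℝ) := Icc_subset_Ici_self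
  have hφcL : ∀ j, ContinuousOn (φ j) (Icc 0 L) := fun j => (hφc j).mono hIcc
  have hLL : L ∈ Icc 0 L := ⟨hL.le, le_rfl⟩
  have hD₀cj : ∀ j, ∀ x ∉ S, ContinuousAt (fun x => D₀ x j) x := fun j x hx =>
    continuousAt_pi.mp (hD₀c x hx) j
  have hD₁cj : ∀ j, ∀ x ∉ S, ContinuousAt (fun x => D₁ x j) x := fun j x hx =>
    continuousAt_pi.mp (hD₁c x hx) j
  have hFcj : ∀ i j, ∀ x ∉ S, ContinuousAt (fun x => F x i j) x := fun i j x hx =>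
    continuousAt_pi.mp (continuousAt_pi.mp (hFc x hx) i) j
  -- the family of all solutions of the coupled system
  set Q₀ : ℝ → Fin 3 → Fin 3 → ℝ := fun x i j => if i = j then D₀ x i - lam₀ else 0 with hQ₀
  set Q : Fin 3 → ℝ → Fin 3 → Fin 3 → ℝ := ![fun x i j => if i = j then D₁ x i else 0,
    fun _ i j => if i = j then -1 else 0, F] with hQ
  obtain ⟨k, Z, hZ, hsol⟩ := exists_second_order_solution_family S (Q₀ := Q₀) (Q := Q)
    (C := CB + 1) (by
      intro x hx
      refine continuousAt_pi.mpr fun i => continuousAt_pi.mpr fun j => ?_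
      by_cases hij : i = j
      · simp only [hQ₀, hij, if_true]
        exact (hD₀cj j x hx).sub continuousAt_const
      · simp only [hQ₀, hij, if_false]
        exact continuousAt_const) (by
      intro a x hx
      refine continuousAt_pi.mpr fun i => continuousAt_pi.mpr fun j => ?_
      fin_cases a
      · by_cases hij : i = j
        · simpa [hQ, hij] using hD₁cj j x hx
        · simpa [hQ, hij] using continuousAt_const
      · simpa [hQ] using continuousAt_const
      · simpa [hQ] using hFcj i j x hx) (by
      intro x i j
      by_cases hij : i = j
      · simp only [hQ₀, hij, if_true]
        refine (abs_sub _ _).trans (add_le_add (hD₀b x j) ?_)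
        rw [abs_of_pos hlam₀.1]
        exact hlam₀.2.le
      · simp only [hQ₀, hij, if_false, abs_zero]
        positivity) (by
      intro a x i j
      fin_cases a
      · by_cases hij : i = j
        · simpa [hQ, hij] using (hD₁b x j).trans (by linarith)
        · simpa [hQ, hij] using (by positivity : 0 ≤ CB + 1)
      · by_cases hij : i = j
        · simpa [hQ, hij] using hCB
        · simpa [hQ, hij] using (by positivity : 0 ≤ CB + 1)
      · simpa [hQ] using (hFb x i j).trans (by linarith)) (by positivity)
  -- the integral functionals entering the solvability conditions
  have hfun : ∀ (q : ℝ → ℝ) (C : ℝ) (_ : ∀ x ∉ S, ContinuousAt q x) (_ : ∀ x, |q x| ≤ C)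
      (i j : Fin 3), ∃ ℓ : (ℝ →ᵇ ((Fin 3 → ℝ) × (Fin 3 → ℝ))) →L[ℝ] ℝ, ∀ z, ℓ z =
        ∫ t in (0 : ℝ)..L, (q t * φ i t) * (Real.exp (k * t) • (z t).1) j := fun q C hq hC i j =>
    exists_integral_functional hL.le
      (intervalIntegrable_mul_of_continuousAt_off_finset S hL.le hq hC (hφcL i))
      ((ContinuousLinearMap.proj j).comp (ContinuousLinearMap.fst ℝ (Fin 3 → ℝ) (Fin 3 → ℝ))) k
  choose ℓD hℓD using fun j => hfun (fun t => D₁ t j) CB (hD₁cj j) (fun x => hD₁b x j) j j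
  choose ℓ1 hℓ1 using fun j => hfun (fun _ => 1) 1 (fun _ _ => continuousAt_const) (by simp) j j
  choose ℓF hℓF using fun j k => hfun (fun t => F t j k) CB (hFcj j k) (fun x => hFb x j k) j k
  -- the uncoupled solutions
  have hunc : ∀ c : Fin 3 → ℝ, ∀ x ∈ Icc 0 L, ∀ j,
      (Real.exp (k * x) • (Z (0, fun j => c j * φ j 0) x).1) j = c j * φ j x ∧
      (Real.exp (k * x) • (Z (0, fun j => c j * φ j 0) x).2) j = c j * φ' j x := by
    intro c x hx j
    obtain ⟨hy, hw, hw0, hy0⟩ := hsol.self_of_nhds (fun j => c j * φ j 0)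
    set z := Z (0, fun j => c j * φ j 0)
    have hyj : ∀ t ∈ Ioo 0 L, HasDerivAt (fun x => (Real.exp (k * x) • (z x).1) j)
        ((Real.exp (k * t) • (z t).2) j) t := fun t ht =>
      hasDerivAt_pi.mp ((hy t ht.1.le).hasDerivAt (Ici_mem_nhds ht.1)) j
    have hwj : ∀ t ∈ Ioo 0 L, t ∉ S → HasDerivAt (fun x => (Real.exp (k * x) • (z x).2) j)
        ((D₀ t j - lam₀) * (Real.exp (k * t) • (z t).1) j) t := fun t ht htS => by
      refine (hasDerivAt_pi.mp (hw t ht.1 htS) j).congr_deriv ?_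
      simp [hQ₀]
    have := eq_zero_of_second_order_ode S (a := 0) (b := L) (x₀ := 0) (C := CB + 1)
      (y := fun x => (Real.exp (k * x) • (z x).1) j - c j * φ j x)
      (w := fun x => (Real.exp (k * x) • (z x).2) j - c j * φ' j x)
      (q := fun x => D₀ x j - lam₀) (fun t _ => by
        refine (abs_sub _ _).trans (add_le_add (hD₀b t j) ?_)
        rw [abs_of_pos hlam₀.1]
        exact hlam₀.2.le)
      ((by fun_prop : Continuous fun x => (Real.exp (k * x) • (z x).1) j).continuousOn.sub
        (continuousOn_const.mul (hφcL j)))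
      ((by fun_prop : Continuous fun x => (Real.exp (k * x) • (z x).2) j).continuousOn.sub
        (continuousOn_const.mul ((hφ'c j).mono hIcc)))
      (fun t ht => (hyj t ht).sub
        (((hφ j t ht.1.le).hasDerivAt (Ici_mem_nhds ht.1)).const_mul (c j)))
      (fun t ht htS => ((hwj t ht htS).sub ((hφ' j t ht.1 htS).const_mul (c j))).congr_deriv
        (by ring))
      ⟨le_rfl, hL.le⟩ (by simp [hy0]) (by simp [hw0, hφ'0]) x hx
    exact ⟨sub_eq_zero.mp this.1, sub_eq_zero.mp this.2⟩
  -- Wronskian identities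
  have hwron : ∀ (σ μ δ : ℝ) (z : ℝ →ᵇ ((Fin 3 → ℝ) × (Fin 3 → ℝ)))
      (_ : ∀ x ∈ Ici (0 : ℝ), HasDerivWithinAt (fun x => Real.exp (k * x) • (z x).1)
          (Real.exp (k * x) • (z x).2) (Ici 0) x)
      (_ : ∀ x ∈ Ioi (0 : ℝ), x ∉ S → HasDerivAt (fun x => Real.exp (k * x) • (z x).2)
          (fun i => ∑ j, (Q₀ x i j + ∑ a, (δ • ![σ, μ, 1] : Fin 3 → ℝ) a * Q a x i j) *
            (Real.exp (k * x) • (z x).1) j) x)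
      (_ : (z 0).2 = 0) (j : Fin 3),
      φ j L * (Real.exp (k * L) • (z L).2) j - φ' j L * (Real.exp (k * L) • (z L).1) j =
        δ * (σ * ℓD j z - μ * ℓ1 j z + ∑ i, ℓF j i z) := by
    intro σ μ δ z hy hw hw0 j
    set y : ℝ → Fin 3 → ℝ := fun x => Real.exp (k * x) • (z x).1 with hydef
    have hyc : ∀ i, Continuous fun x => y x i := fun i => by fun_prop
    have hi : ∀ (q : ℝ → ℝ) (C : ℝ) (_ : ∀ x ∉ S, ContinuousAt q x) (_ : ∀ x, |q x| ≤ C)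
        (i : Fin 3), IntervalIntegrable (fun t => q t * φ j t * y t i) volume 0 L :=
      fun q C hq hC i =>
      (intervalIntegrable_mul_of_continuousAt_off_finset S hL.le hq hC (hφcL j)).mul_continuousOn
        (hyc i).continuousOn
    have hi1 := hi (fun t => D₁ t j) CB (hD₁cj j) (fun x => hD₁b x j) j
    have hi2 := hi (fun _ => 1) 1 (fun _ _ => continuousAt_const) (by simp) j
    have hi3 := fun i => hi (fun t => F t j i) CB (hFcj j i) (fun x => hFb x j i) i
    have hi3' : IntervalIntegrable (fun t => ∑ i, F t j i * φ j t * y t i) volume 0 L := by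
      have := IntervalIntegrable.sum Finset.univ (f := fun i t => F t j i * φ j t * y t i)
        (fun i _ => hi3 i)
      simpa [Finset.sum_fn] using this
    have hitot := (((hi1.const_mul σ).sub (hi2.const_mul μ)).add hi3').const_mul δ
    have heq : (fun t => φ j t * (δ * (σ * D₁ t j * y t j - μ * y t j + ∑ i, F t j i * y t i))) =
        fun t => δ * (σ * (D₁ t j * φ j t * y t j) - μ * (1 * φ j t * y t j) +
          ∑ i, F t j i * φ j t * y t i) := by
      funext t
      simp only [Fin.sum_univ_three]
      ring
    have hW := wronskian_eq_integral S hL.le (u := φ j) (u' := φ' j) (y := fun x => y x j)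
      (y' := fun x => (Real.exp (k * x) • (z x).2) j) (q := fun x => D₀ x j - lam₀)
      (r := fun t => δ * (σ * D₁ t j * y t j - μ * y t j + ∑ i, F t j i * y t i))
      (hφcL j) ((hφ'c j).mono hIcc) (hyc j).continuousOn
      (by fun_prop : Continuous fun x => (Real.exp (k * x) • (z x).2) j).continuousOn
      (fun t ht => (hφ j t ht.1.le).hasDerivAt (Ici_mem_nhds ht.1))
      (fun t ht => hasDerivAt_pi.mp ((hy t ht.1.le).hasDerivAt (Ici_mem_nhds ht.1)) j)
      (fun t ht htS => hφ' j t ht.1 htS)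
      (fun t ht htS => (hasDerivAt_pi.mp (hw t ht.1 htS) j).congr_deriv (by
        fin_cases j <;> simp [hydef, hQ₀, hQ, Fin.sum_univ_three] <;> ring))
      (by rw [heq]; exact hitot) (hφ'0 j) (by simp [hw0])
    rw [hW, heq, intervalIntegral.integral_const_mul, intervalIntegral.integral_add
      ((hi1.const_mul σ).sub (hi2.const_mul μ)) hi3', intervalIntegral.integral_sub
      (hi1.const_mul σ) (hi2.const_mul μ), intervalIntegral.integral_const_mul,
      intervalIntegral.integral_const_mul, intervalIntegral.integral_finsetSum fun i _ => hi3 i,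
      hℓD, hℓ1]
    simp only [hℓF]
    rfl
  -- boundary values
  have hev : ∀ A : ((Fin 3 → ℝ) × (Fin 3 → ℝ)) →L[ℝ] ℝ,
      ∃ e : (ℝ →ᵇ ((Fin 3 → ℝ) × (Fin 3 → ℝ))) →L[ℝ] ℝ, ∀ z, e z = Real.exp (k * L) * A (z L) :=
    fun A => ⟨Real.exp (k * L) • A.comp (BoundedContinuousFunction.evalCLM ℝ L), fun z => rfl⟩
  choose eY heY using fun j : Fin 3 => hev
    ((ContinuousLinearMap.proj j).comp (ContinuousLinearMap.fst ℝ (Fin 3 → ℝ) (Fin 3 → ℝ)))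
  choose eW heW using fun j : Fin 3 => hev
    ((ContinuousLinearMap.proj j).comp (ContinuousLinearMap.snd ℝ (Fin 3 → ℝ) (Fin 3 → ℝ)))
  replace heY : ∀ j z, eY j z = (Real.exp (k * L) • (z L).1) j := heY
  replace heW : ∀ j z, eW j z = (Real.exp (k * L) • (z L).2) j := heW
  -- the solvability map
  set p : ((Fin 3 → ℝ) × ℝ × ℝ) × ℝ → Fin 3 → ℝ := fun v => v.2 • ![v.1.2.1, v.1.2.2, 1] with hp
  set z : ((Fin 3 → ℝ) × ℝ × ℝ) × ℝ → ℝ →ᵇ ((Fin 3 → ℝ) × (Fin 3 → ℝ)) :=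
    fun v => Z (p v, fun j => v.1.1 j * φ j 0) with hz
  set h : Fin 3 → ((Fin 3 → ℝ) × ℝ × ℝ) × ℝ → ℝ := fun j v => if j = 0 then 0 else
    v.1.2.2 * φ j L / (Real.sqrt (1 - (lam₀ + v.2 * v.1.2.2)) + κ₀) with hh
  set H : ((Fin 3 → ℝ) × ℝ × ℝ) × ℝ → ℝ × (Fin 3 → ℝ) := fun v =>
    (φ 0 L * eY 0 (z v) + φ' 0 L * eW 0 (z v), fun j => v.1.2.1 * ℓD j (z v) -
      v.1.2.2 * ℓ1 j (z v) + ∑ i, ℓF j i (z v) - h j v * eY j (z v)) with hH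
  set R : ℝ := φ 0 L ^ 2 + φ' 0 L ^ 2 with hRdef
  set d : Fin 3 → ℝ := fun j => ∫ x in (0 : ℝ)..L, D₁ x j * φ j x ^ 2 with hddef
  set n : Fin 3 → ℝ := fun j => (∫ x in (0 : ℝ)..L, φ j x ^ 2) +
    if j = 0 then 0 else φ j L ^ 2 / (2 * κ₀) with hndef
  set Γ : Fin 3 → Fin 3 → ℝ := fun j i => ∫ x in (0 : ℝ)..L, φ j x * (F x j i * φ i x) with hΓdef
  have hκsqrt : Real.sqrt (1 - lam₀) = κ₀ := by rw [← hκ₀sq, Real.sqrt_sq hκ₀.le]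
  have hH0 : ∀ (c : Fin 3 → ℝ) (σ μ : ℝ), H ((c, σ, μ), 0) =
      (c 0 * R, fun j => σ * c j * d j - μ * c j * n j + ∑ i, c i * Γ j i) := by
    intro c σ μ
    have hz0 : z ((c, σ, μ), 0) = Z (0, fun j => c j * φ j 0) := by simp only [hz, hp, zero_smul]
    have hint : ∀ (q : ℝ → ℝ) (j i : Fin 3), (∫ t in (0 : ℝ)..L, (q t * φ j t) *
        (Real.exp (k * t) • (Z (0, fun j => c j * φ j 0) t).1) i) =
        c i * ∫ t in (0 : ℝ)..L, φ j t * (q t * φ i t) := fun q j i => by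
      rw [← intervalIntegral.integral_const_mul]
      refine intervalIntegral.integral_congr fun t ht => ?_
      rw [uIcc_of_le hL.le] at ht
      simp only [(hunc c t ht i).1]
      ring
    have hY : ∀ j, eY j (Z (0, fun j => c j * φ j 0)) = c j * φ j L := fun j => by
      rw [heY, (hunc c L hLL j).1]
    have hW : eW 0 (Z (0, fun j => c j * φ j 0)) = c 0 * φ' 0 L := by
      rw [heW, (hunc c L hLL 0).2]
    simp only [hH, hz0, hY, hW, hℓD, hℓ1, hℓF, hint]
    refine Prod.ext (by simp only [hRdef]; ring) (funext fun j => ?_)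
    have e1 : (∫ t in (0 : ℝ)..L, φ j t * (D₁ t j * φ j t)) = d j := by
      simp only [hddef]
      congr 1
      funext t
      ring
    have e2 : (∫ t in (0 : ℝ)..L, φ j t * (1 * φ j t)) = ∫ t in (0 : ℝ)..L, φ j t ^ 2 := by
      congr 1
      funext t
      ring
    have e3 : h j ((c, σ, μ), 0) * (c j * φ j L) =
        μ * c j * if j = 0 then 0 else φ j L ^ 2 / (2 * κ₀) := by
      by_cases hj : j = 0
      · simp [hh, hj]
      · simp only [hh, hj, if_false, zero_mul, add_zero, hκsqrt]
        field_simp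
        ring
    simp only [e1, e2, e3, hndef, hΓdef]
    ring
  obtain ⟨c₀, σ₀, μ₀, hc0, hc1, hzero, hsurj⟩ := exists_reduced_crossing_solution (R := R) hR
    (d := d) (n := n) (Γ := Γ) (by simpa [hndef] using hnorm 1 (by decide))
    (by simpa [hndef] using hnorm 2 (by decide)) hd h1 h2 (fun j => by simp [hΓdef, hFdiag])
  have hpz : p ((c₀, σ₀, μ₀), 0) = 0 := by simp only [hp, zero_smul]
  have hpC : ContDiff ℝ 1 p := by
    refine contDiff_pi.mpr fun i => ?_
    fin_cases i <;> simp [hp] <;> fun_prop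
  have hcC : ContDiff ℝ 1 fun v : ((Fin 3 → ℝ) × ℝ × ℝ) × ℝ => fun j => v.1.1 j * φ j 0 :=
    contDiff_pi.mpr fun i => by fun_prop
  have hzC : ContDiffAt ℝ 1 z ((c₀, σ₀, μ₀), 0) :=
    ContDiffAt.comp ((c₀, σ₀, μ₀), (0 : ℝ)) (g := Z) (f := fun v => (p v, fun j => v.1.1 j * φ j 0))
      (by rw [hpz]; exact hZ _) (hpC.prodMk hcC).contDiffAt
  have hlz : ∀ ℓ : (ℝ →ᵇ ((Fin 3 → ℝ) × (Fin 3 → ℝ))) →L[ℝ] ℝ,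
      ContDiffAt ℝ 1 (fun v => ℓ (z v)) ((c₀, σ₀, μ₀), 0) := fun ℓ =>
    ℓ.contDiff.contDiffAt.comp _ hzC
  have hhC : ∀ j, ContDiffAt ℝ 1 (h j) ((c₀, σ₀, μ₀), 0) := fun j => by
    by_cases hj : j = 0
    · simp only [hh, hj, if_true]
      exact contDiffAt_const
    · simp only [hh, hj, if_false]
      refine ContDiffAt.div (by fun_prop) (ContDiffAt.add (ContDiffAt.sqrt (by fun_prop) ?_)
        contDiffAt_const) ?_
      · simpa using (sub_pos.mpr hlam₀.2).ne'
      · simp only [zero_mul, add_zero, hκsqrt]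
        positivity
  have hHC : ContDiffAt ℝ 1 H ((c₀, σ₀, μ₀), 0) := by
    refine ContDiffAt.prodMk ((contDiffAt_const.mul (hlz _)).add (contDiffAt_const.mul (hlz _)))
      (contDiffAt_pi.mpr fun j => ?_)
    refine ContDiffAt.sub (ContDiffAt.add (ContDiffAt.sub (ContDiffAt.mul (by fun_prop) (hlz _))
      (ContDiffAt.mul (by fun_prop) (hlz _))) (ContDiffAt.sum fun i _ => hlz _))
      ((hhC j).mul (hlz _))
  have hsurjH : ∀ y, ∃ w, HasDerivAt (fun t : ℝ => H ((c₀, σ₀, μ₀) + t • w, 0)) y 0 := by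
    rintro ⟨g₀, g⟩
    obtain ⟨c, σ, μ, hc, hcj⟩ := hsurj g₀ g
    refine ⟨(c, σ, μ), ?_⟩
    have ha : ∀ a b : ℝ, HasDerivAt (fun t : ℝ => a + t * b) b 0 := fun a b => by
      simpa using ((hasDerivAt_id (0 : ℝ)).mul_const b).const_add a
    have heq : (fun t : ℝ => H ((c₀, σ₀, μ₀) + t • (c, σ, μ), 0)) = fun t : ℝ =>
        ((c₀ 0 + t * c 0) * R, fun j => (σ₀ + t * σ) * (c₀ j + t * c j) * d j -
          (μ₀ + t * μ) * (c₀ j + t * c j) * n j + ∑ i, (c₀ i + t * c i) * Γ j i) := by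
      funext t
      exact hH0 _ _ _
    rw [heq]
    refine HasDerivAt.prodMk (((ha _ _).mul_const R).congr_deriv hc)
      (hasDerivAt_pi.mpr fun j => ?_)
    refine ((((((ha σ₀ σ).mul (ha (c₀ j) (c j))).mul_const (d j)).sub
      (((ha μ₀ μ).mul (ha (c₀ j) (c j))).mul_const (n j))).add
      (HasDerivAt.fun_sum fun i _ => (ha (c₀ i) (c i)).mul_const (Γ j i)))).congr_deriv ?_
    rw [← hcj j]
    simp
  have hPt : ∀ f : ((Fin 3 → ℝ) × ℝ × ℝ) × ℝ → ℝ, Continuous f → f ((c₀, σ₀, μ₀), 0) = 0 →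
      ∀ r > 0, ∀ᶠ v in nhds ((c₀, σ₀, μ₀), (0 : ℝ)), |f v| < r := fun f hf hf0 r hr =>
    (hf.abs.tendsto' _ 0 (by simp [hf0])).eventually_lt_const hr
  have hP1 := (hpC.continuous.tendsto' ((c₀, σ₀, μ₀), (0 : ℝ)) 0 hpz).eventually hsol
  have hP2 : ∀ᶠ v in nhds ((c₀, σ₀, μ₀), (0 : ℝ)), eY 1 (z v) ≠ 0 := by
    refine (hlz (eY 1)).continuousAt.eventually_ne ?_
    have : z ((c₀, σ₀, μ₀), 0) = Z (0, fun j => c₀ j * φ j 0) := by simp only [hz, hp, zero_smul]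
    rw [this, heY, (hunc c₀ L hLL 1).1]
    exact mul_ne_zero hc1 (hφL0 1 (by decide))
  have hP3 := hPt (fun v => v.2 * v.1.2.1) (by fun_prop) (by simp) ε hε
  have hP4 := hPt (fun v => v.2 * v.1.2.2) (by fun_prop) (by simp) (min ε (min lam₀ (1 - lam₀)))
    (lt_min hε (lt_min hlam₀.1 (sub_pos.mpr hlam₀.2)))
  obtain ⟨δ₀, hδ₀, hmain⟩ := exists_zero_near_of_surjective_partial_deriv hHC
    (by rw [hH0, hc0]; exact Prod.ext (by simp) (funext hzero)) hsurjH
    (hP1.and (hP2.and (hP3.and hP4)))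
  refine ⟨δ₀, hδ₀, fun δ hδ => ?_⟩
  obtain ⟨⟨c, σ, μ⟩, ⟨hs, hy1, hσ, hμ⟩, hHv⟩ := hmain δ hδ
  obtain ⟨hy, hw, hw0, -⟩ := hs fun j => c j * φ j 0
  change |δ * σ| < ε at hσ
  change |δ * μ| < _ at hμ
  obtain ⟨hμε, hμ'⟩ := lt_min_iff.mp hμ
  obtain ⟨hμ0, hμ1⟩ := lt_min_iff.mp hμ'
  have hlam : lam₀ + δ * μ ∈ Ioo (0 : ℝ) 1 :=
    ⟨by linarith [(abs_lt.mp hμ0).1], by linarith [(abs_lt.mp hμ1).2]⟩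
  have hG0 : φ 0 L * eY 0 (z ((c, σ, μ), δ)) + φ' 0 L * eW 0 (z ((c, σ, μ), δ)) = 0 :=
    congrArg Prod.fst hHv
  have hG : ∀ j, σ * ℓD j (z ((c, σ, μ), δ)) - μ * ℓ1 j (z ((c, σ, μ), δ)) +
      ∑ i, ℓF j i (z ((c, σ, μ), δ)) - h j ((c, σ, μ), δ) * eY j (z ((c, σ, μ), δ)) = 0 := fun j =>
    congrFun (congrArg Prod.snd hHv) j
  have hWr := hwron σ μ δ (z ((c, σ, μ), δ)) hy hw hw0
  simp only [← heY, ← heW] at hWr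
  have hWr' : ∀ j, φ j L * eW j (z ((c, σ, μ), δ)) - φ' j L * eY j (z ((c, σ, μ), δ)) =
      δ * h j ((c, σ, μ), δ) * eY j (z ((c, σ, μ), δ)) := fun j => by
    rw [hWr j]
    linear_combination δ * hG j
  have hW0 := hWr' 0
  simp only [hh, if_true, mul_zero, zero_mul] at hW0
  have hκ := Real.sqrt_nonneg (1 - (lam₀ + δ * μ))
  have hκsq := Real.sq_sqrt (sub_nonneg.mpr hlam.2.le)
  refine ⟨δ * σ, lam₀ + δ * μ, hσ, by simpa using hμε, hlam,
    fun x => Real.exp (k * x) • (z ((c, σ, μ), δ) x).1,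
    fun x => Real.exp (k * x) • (z ((c, σ, μ), δ) x).2, hy, by fun_prop, fun x hx hxS => ?_,
    by simpa using hw0, fun h0 => hy1 ?_, ?_, ?_, fun j hj => ?_⟩
  · refine (hw x hx hxS).congr_deriv (funext fun i => ?_)
    fin_cases i <;> simp [hp, hz, hQ₀, hQ, Fin.sum_univ_three] <;> ring
  · rw [heY]
    exact congrFun h0 1
  · beta_reduce
    rw [← heY]
    refine (mul_eq_zero.mp ?_).resolve_left hR
    rw [hRdef]
    linear_combination φ 0 L * hG0 - φ' 0 L * hW0
  · beta_reduce
    rw [← heW]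
    refine (mul_eq_zero.mp ?_).resolve_left hR
    rw [hRdef]
    linear_combination φ' 0 L * hG0 + φ 0 L * hW0
  · beta_reduce
    rw [← heW, ← heY]
    have hWj := hWr' j
    simp only [hh, hj, if_false, hφL j hj] at hWj
    refine mul_left_cancel₀ (hφL0 j hj) ?_
    set κ := Real.sqrt (1 - (lam₀ + δ * μ))
    have hne : κ + κ₀ ≠ 0 := by positivity
    have hδμ : δ * (μ * φ j L / (κ + κ₀)) = (κ₀ - κ) * φ j L := by
      field_simp
      linear_combination φ j L * (hκsq - hκ₀sq)
    rw [hδμ] at hWj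
    linear_combination hWj

end

/-- Theorem 6.5 (main result): existence of Friedrich–Wintgen BICs.  Consider
`-y'' + V(x) y = λ y` on `(0,∞)` with `y'(0) = 0` and
`V(x) = D(x;s) + δ F(x)`, where `D(x;s) = D0(x) + (s-s0) D1(x)` is real
diagonal, `F` is real symmetric with zero diagonal, all entries piecewise
smooth, and `D(x;s) = diag(0,1,1)`, `F(x) = 0` for `x ≥ L` (assumption A1).
Assume (A2) that the uncoupled system has bound states `φ_i(·;s)` with
eigenvalues `μ_i(s) ∈ (0,1)` for `s` in an interval `I_s`, with a crossing
`μ1(s0) = μ2(s0) = λ0 ∈ (0,1)` at `s0 ∈ I_s` and `⟨Φ1,D1Φ1⟩ ≠ ⟨Φ2,D1Φ2⟩`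
(`Φ1, Φ2` normalized), and (A3) that `⟨Φ0,FΦ1⟩ ≠ 0 ≠ ⟨Φ0,FΦ2⟩` with
`|⟨Φ0,FΦ1⟩|² + |⟨Φ0,FΦ2⟩|² = 1`, `Φ0` built from the scattering solution `φ0`.
Then for every sufficiently small `δ ≠ 0` the coupled system has a BIC: a
nontrivial solution `y` with frequency `λ ∈ (0,1)`, `y'(0) = 0`, `y → 0` at
`+∞`, for some `(s, λ)` near the crossing point `(s0, λ0)`. -/
theorem friedrich_wintgen_BIC_exists
    (L s0 lam0 θ0 : ℝ) (hL : 0 < L) (hlam0 : lam0 ∈ Set.Ioo (0 : ℝ) 1)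
    (D0 D1 : ℝ → Fin 3 → ℝ) (F : ℝ → Fin 3 → Fin 3 → ℝ)
    -- piecewise smoothness and boundedness of the coefficients
    (ED : Finset ℝ)
    (hD0sm : ∀ x ∉ (ED : Set ℝ), ContDiffAt ℝ (⊤ : ℕ∞) D0 x)
    (hD1sm : ∀ x ∉ (ED : Set ℝ), ContDiffAt ℝ (⊤ : ℕ∞) D1 x)
    (hFsm : ∀ x ∉ (ED : Set ℝ), ContDiffAt ℝ (⊤ : ℕ∞) F x)
    (CB : ℝ)
    (hbdd : ∀ x, (∀ i, |D0 x i| ≤ CB ∧ |D1 x i| ≤ CB) ∧ ∀ i j, |F x i j| ≤ CB)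
    -- structure of the potential (A1 and (2.10)-(2.11))
    (hD0L : ∀ x ≥ L, D0 x = ![0, 1, 1])
    (hD1L : ∀ x ≥ L, D1 x = 0)
    (hFL : ∀ x ≥ L, F x = 0)
    (hFsymm : ∀ x i j, F x i j = F x j i)
    (hFdiag : ∀ x i, F x i i = 0)
    -- assumption A2: two families of bound states with a crossing at s0
    (Is : Set ℝ) (hs0 : s0 ∈ Is)
    (μ1 μ2 : ℝ → ℝ)
    (hμrange : ∀ s ∈ Is, μ1 s ∈ Set.Ioo (0 : ℝ) 1 ∧ μ2 s ∈ Set.Ioo (0 : ℝ) 1)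
    (hfam : ∀ s ∈ Is,
      (∃ ψ ψ' : ℝ → ℝ,
        IsBoundState1D (fun x => D0 x 1 + (s - s0) * D1 x 1) (μ1 s) ψ ψ') ∧
      (∃ ψ ψ' : ℝ → ℝ,
        IsBoundState1D (fun x => D0 x 2 + (s - s0) * D1 x 2) (μ2 s) ψ ψ'))
    (hcross1 : μ1 s0 = lam0) (hcross2 : μ2 s0 = lam0)
    -- the bound states φ1, φ2 at the crossing, normalized
    (φ1 φ1' φ2 φ2' : ℝ → ℝ)
    (hφ1 : IsBoundState1D (fun x => D0 x 1) lam0 φ1 φ1')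
    (hφ2 : IsBoundState1D (fun x => D0 x 2) lam0 φ2 φ2')
    (hφ1norm : ∫ x in Set.Ioi (0 : ℝ), (φ1 x) ^ 2 = 1)
    (hφ2norm : ∫ x in Set.Ioi (0 : ℝ), (φ2 x) ^ 2 = 1)
    -- A2: non-tangential crossing, ⟨Φ1,D1Φ1⟩ ≠ ⟨Φ2,D1Φ2⟩
    (hA2 : (∫ x in Set.Ioi (0 : ℝ), D1 x 1 * (φ1 x) ^ 2) ≠
           (∫ x in Set.Ioi (0 : ℝ), D1 x 2 * (φ2 x) ^ 2))
    -- assumption A3: the scattering solution φ0 and the coupling conditions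
    (φ0 φ0' : ℝ → ℝ)
    (hφ0 : Sol1D (fun x => D0 x 0) lam0 (fun _ => 0) φ0 φ0')
    (hφ0L : ∀ x > L, φ0 x = Real.cos (Real.sqrt lam0 * x + θ0 / 2))
    (hA3a : (∫ x in Set.Ioi (0 : ℝ), φ0 x * (F x 0 1 * φ1 x)) ≠ 0)
    (hA3b : (∫ x in Set.Ioi (0 : ℝ), φ0 x * (F x 0 2 * φ2 x)) ≠ 0)
    (hA3n : (∫ x in Set.Ioi (0 : ℝ), φ0 x * (F x 0 1 * φ1 x)) ^ 2 +
            (∫ x in Set.Ioi (0 : ℝ), φ0 x * (F x 0 2 * φ2 x)) ^ 2 = 1) :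
    ∀ ε > 0, ∃ δ0 > 0, ∀ δ : ℝ, δ ≠ 0 → |δ| < δ0 →
      ∃ s lam : ℝ, |s - s0| < ε ∧ |lam - lam0| < ε ∧ lam ∈ Set.Ioo (0 : ℝ) 1 ∧
        ∃ y y' : ℝ → Fin 3 → ℝ,
          VSol (fun x i j =>
              (if i = j then D0 x i + (s - s0) * D1 x i else 0) + δ * F x i j)
            lam y y' ∧
          Filter.Tendsto y Filter.atTop (nhds 0) ∧
          ∃ x ∈ Set.Ici (0 : ℝ), y x ≠ 0 := by
  set φ : Fin 3 → ℝ → ℝ := ![φ0, φ1, φ2]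
  set φ' : Fin 3 → ℝ → ℝ := ![φ0', φ1', φ2']
  have hS : ∀ j, Sol1D (fun x => D0 x j) lam0 (fun _ => 0) (φ j) (φ' j) := fun j => by
    fin_cases j
    exacts [hφ0, hφ1.1, hφ2.1]
  have hdecay : ∀ j, j ≠ 0 → Tendsto (φ j) atTop (nhds 0) := fun j hj => by
    fin_cases j
    exacts [absurd rfl hj, hφ1.2.1, hφ2.2.1]
  have hnorm : ∀ j, j ≠ 0 → ∫ x in Ioi (0 : ℝ), φ j x ^ 2 = 1 := fun j hj => by
    fin_cases j
    exacts [absurd rfl hj, hφ1norm, hφ2norm]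
  have hD0one : ∀ j, j ≠ 0 → ∀ x ≥ L, D0 x j = 1 := fun j hj x hx => by
    rw [hD0L x hx]
    fin_cases j
    exacts [absurd rfl hj, rfl, rfl]
  choose hφ hφ'c hE hφ'0 using hS
  choose E hE using hE
  set S : Finset ℝ := ED ∪ Finset.univ.biUnion E with hSdef
  have hSD : ∀ x, x ∉ S → x ∉ (ED : Set ℝ) := fun x hx h =>
    hx (Finset.mem_union_left _ h)
  have hφ' : ∀ j, ∀ x ∈ Ioi (0 : ℝ), x ∉ S → HasDerivAt (φ' j) ((D0 x j - lam0) * φ j x) x := by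
    intro j x hx hxS
    refine (hE j x hx fun h => hxS ?_).congr_deriv (by ring)
    exact Finset.mem_union_right _ (Finset.mem_biUnion.mpr ⟨j, Finset.mem_univ _, h⟩)
  have hφc : ∀ j, ContinuousOn (φ j) (Ici 0) := fun j x hx => (hφ j x hx).continuousWithinAt
  have hφd : ∀ j, ∀ x ∈ Ioi (0 : ℝ), HasDerivAt (φ j) (φ' j x) x := fun j x hx =>
    (hφ j x (mem_Ioi.mp hx).le).hasDerivAt (Ici_mem_nhds hx)
  have hIci : Ici L ⊆ Ici (0 : ℝ) := Ici_subset_Ici.mpr hL.le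
  have hIoi : ∀ x ∈ Ioi L, x ∈ Ioi (0 : ℝ) := fun x hx => hL.trans hx
  set κ0 := Real.sqrt (1 - lam0)
  have hκ0 : 0 < κ0 := Real.sqrt_pos.mpr (sub_pos.mpr hlam0.2)
  have hκ0sq : κ0 ^ 2 = 1 - lam0 := Real.sq_sqrt (sub_nonneg.mpr hlam0.2.le)
  have hφ'tail : ∀ j, j ≠ 0 → ∀ x ∈ Ioi L, x ∉ S → HasDerivAt (φ' j) (κ0 ^ 2 * φ j x) x :=
    fun j hj x hx hxS => by
      rw [hκ0sq, ← hD0one j hj x (le_of_lt hx)]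
      exact hφ' j x (hIoi x hx) hxS
  have hφL : ∀ j, j ≠ 0 → φ' j L = -κ0 * φ j L := fun j hj =>
    deriv_eq_of_tail_tendsto_zero S hκ0 ((hφc j).mono hIci) ((hφ'c j).mono hIci)
      (fun x hx => hφd j x (hIoi x hx)) (hφ'tail j hj) (hdecay j hj)
  have htail : ∀ j, j ≠ 0 → ∀ x, L ≤ x → φ j x = φ j L * Real.exp (-κ0 * (x - L)) :=
    fun j hj x hx => by
      rw [tail_eq_exp S hκ0 ((hφc j).mono hIci) ((hφ'c j).mono hIci)
        (fun x hx => hφd j x (hIoi x hx)) (hφ'tail j hj) hx, hφL j hj]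
      simp
  have hvanish : ∀ j, φ j L = 0 → φ' j L = 0 → ∀ x ∈ Icc 0 L, φ j x = 0 := fun j h h' x hx =>
    (eq_zero_of_second_order_ode S (q := fun x => D0 x j - lam0) (C := CB + 1)
      (fun t _ => by
        refine (abs_sub _ _).trans (add_le_add ((hbdd t).1 j).1 ?_)
        rw [abs_of_pos hlam0.1]
        exact hlam0.2.le)
      ((hφc j).mono Icc_subset_Ici_self) ((hφ'c j).mono Icc_subset_Ici_self)
      (fun t ht => hφd j t ht.1) (fun t ht => hφ' j t ht.1) (right_mem_Icc.mpr hL.le) h h' x hx).1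
  have hA3 : ∀ j, j ≠ 0 → (∫ x in (0 : ℝ)..L, φ 0 x * (F x 0 j * φ j x)) ≠ 0 := fun j hj => by
    rw [← setIntegral_Ioi_eq_intervalIntegral hL.le fun x hx => by simp [hFL x hx]]
    fin_cases j
    exacts [absurd rfl hj, hA3a, hA3b]
  have hφL0 : ∀ j, j ≠ 0 → φ j L ≠ 0 := fun j hj h => hA3 j hj <| by
    rw [intervalIntegral.integral_congr (g := fun _ => 0), intervalIntegral.integral_zero]
    intro x hx
    rw [uIcc_of_le hL.le] at hx
    simp [hvanish j h (by rw [hφL j hj, h, mul_zero]) x hx]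
  have hR : φ 0 L ^ 2 + φ' 0 L ^ 2 ≠ 0 := fun h => hA3 1 (by decide) <| by
    have h0 : φ 0 L = 0 := by nlinarith [sq_nonneg (φ 0 L), sq_nonneg (φ' 0 L)]
    have h0' : φ' 0 L = 0 := by nlinarith [sq_nonneg (φ 0 L), sq_nonneg (φ' 0 L)]
    rw [intervalIntegral.integral_congr (g := fun _ => 0), intervalIntegral.integral_zero]
    intro x hx
    rw [uIcc_of_le hL.le] at hx
    simp [hvanish 0 h0 h0' x hx]
  have hd : (∫ x in (0 : ℝ)..L, D1 x 1 * φ 1 x ^ 2) ≠ ∫ x in (0 : ℝ)..L, D1 x 2 * φ 2 x ^ 2 := by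
    rw [← setIntegral_Ioi_eq_intervalIntegral hL.le fun x hx => by simp [hD1L x hx],
      ← setIntegral_Ioi_eq_intervalIntegral hL.le fun x hx => by simp [hD1L x hx]]
    exact hA2
  intro ε hε
  obtain ⟨δ₀, hδ₀, hmain⟩ := exists_matching_solution (S := S) (CB := CB) (D₀ := D0) (D₁ := D1)
    (F := F) (φ := φ) (φ' := φ') hL hlam0 hκ0 hκ0sq
    (fun x hx => (hD0sm x (hSD x hx)).continuousAt) (fun x hx => (hD1sm x (hSD x hx)).continuousAt)
    (fun x hx => (hFsm x (hSD x hx)).continuousAt) (fun x i => ((hbdd x).1 i).1)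
    (fun x i => ((hbdd x).1 i).2) (fun x => (hbdd x).2) hFdiag hφ hφ'c hφ' hφ'0 hφL hφL0 hR
    (fun j hj => by
      rw [← hnorm j hj, integral_sq_of_exp_tail hL.le hκ0
        ((hφc j).mono Icc_subset_Ici_self) (htail j hj)])
    hd (hA3 1 (by decide)) (hA3 2 (by decide)) hε
  refine ⟨δ₀, hδ₀, fun δ _ hδ => ?_⟩
  obtain ⟨s, lam, hs, hlamε, hlam, y, w, hy, hwc, hw, hw0, hyL, hy0, hwL0, hwL⟩ := hmain δ hδ
  refine ⟨s0 + s, lam, by simpa using hs, hlamε, hlam, y, w,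
    ⟨hy, hwc.continuousOn, ⟨S, fun x hx hxS => ?_⟩, hw0⟩, ?_, L, hL.le, hyL⟩
  · rw [add_sub_cancel_left]
    exact hw x hx (by simpa using hxS)
  have hyc : ∀ j, ContinuousOn (fun x => y x j) (Ici L) := fun j x hx =>
    ((hasDerivWithinAt_pi.mp (hy x (hIci hx)) j).continuousWithinAt).mono hIci
  have hyd : ∀ j, ∀ x ∈ Ioi L, HasDerivAt (fun x => y x j) (w x j) x := fun j x hx =>
    (hasDerivWithinAt_pi.mp (hy x (hIci (mem_Ioi.mp hx).le)) j).hasDerivAt (Ici_mem_nhds (hIoi x hx))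
  have hwcj : ∀ j, Continuous fun x => w x j := fun j => by fun_prop
  have hwd : ∀ j, ∀ x ∈ Ioi L, x ∉ S → HasDerivAt (fun x => w x j) ((D0 x j - lam) * y x j) x :=
    fun j x hx hxS => by
      refine (hasDerivAt_pi.mp (hw x (hIoi x hx) hxS) j).congr_deriv ?_
      simp [hD1L x (le_of_lt hx), hFL x (le_of_lt hx)]
      ring
  refine tendsto_pi_nhds.mpr fun j => ?_
  by_cases hj : j = 0
  · subst hj
    refine tendsto_const_nhds.congr' ((eventually_ge_atTop L).mono fun b hb => ?_)
    refine ((eq_zero_of_second_order_ode S (q := fun x => D0 x 0 - lam) (C := CB + 1)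
      (fun t _ => ?_) ((hyc 0).mono Icc_subset_Ici_self) (hwcj 0).continuousOn
      (fun t ht => hyd 0 t ht.1) (fun t ht => hwd 0 t ht.1) (left_mem_Icc.mpr hb) hy0 hwL0 b
      (right_mem_Icc.mpr hb)).1).symm
    refine (abs_sub _ _).trans (add_le_add ((hbdd t).1 0).1 ?_)
    rw [abs_of_pos hlam.1]
    exact hlam.2.le
  · set κ := Real.sqrt (1 - lam)
    have hκ : 0 < κ := Real.sqrt_pos.mpr (sub_pos.mpr hlam.2)
    have hκsq : κ ^ 2 = 1 - lam := Real.sq_sqrt (sub_nonneg.mpr hlam.2.le)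
    have hyt : ∀ x, L ≤ x → y x j = y L j * Real.exp (-κ * (x - L)) := fun x hx => by
      have := tail_eq_exp S hκ (hyc j) (hwcj j).continuousOn (hyd j) (fun x hx hxS => by
        rw [hκsq, ← hD0one j hj x (le_of_lt hx)]
        exact hwd j x hx hxS) hx
      rw [this, hwL j hj]
      simp
    have hlin : Tendsto (fun x : ℝ => κ * (x - L)) atTop atTop :=
      (tendsto_atTop_add_const_right _ (-L) tendsto_id).const_mul_atTop hκ
    have hexp := (Real.tendsto_exp_neg_atTop_nhds_zero.comp hlin).const_mul (y L j)
    rw [mul_zero] at hexp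
    refine hexp.congr' ((eventually_ge_atTop L).mono fun x hx => ?_)
    simp [hyt x hx]

end
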